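/- Let f and g be transcendental entire functions. Then f ∘ g has infinitely many nonreal fixed points; that is, the set {z ∈ ℂ : f(g(z)) = z and Im z ≠ 0} is infinite. -/

import Mathlib

section
open Set Filter Topology Metric Complex


lemma local_cover {h : ℂ → ℂ} {p : ℂ} {t : ℝ} (ht : 0 < t)
    (hh : DifferentiableOn ℂ h (ball p t)) (hD : deriv h p ≠ 0)
    (hb : ∀ z ∈ ball p t, ‖deriv h z‖ ≤ 2 * ‖deriv h p‖) :
    ball (h p) (‖deriv h p‖ * t / 24) ⊆ h '' closedBall p (t/6) := by
  set D := ‖deriv h p‖ with hDdef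
  have hDpos : 0 < D := norm_pos_iff.2 hD
  have hd : DifferentiableOn ℂ (deriv h) (ball p t) := hh.deriv isOpen_ball
  have h1 : ∀ z ∈ ball p t, ‖deriv h z - deriv h p‖ ≤ 3 * D / t * ‖z - p‖ := by
    intro z hz
    have := Complex.dist_le_div_mul_dist_of_mapsTo_ball (R₂ := 3 * D) hd (by
      intro w hw
      rw [mem_closedBall, dist_eq_norm]
      calc _ ≤ ‖deriv h w‖ + ‖deriv h p‖ := norm_sub_le _ _
        _ ≤ _ := by have := hb w hw; linarith) hz
    simpa [dist_eq_norm] using this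
  have hsub : closedBall p (t/6) ⊆ ball p t := closedBall_subset_ball (by linarith)
  have h2 : ∀ z ∈ closedBall p (t/6), ‖h z - h p - deriv h p * (z - p)‖ ≤ D/2 * ‖z - p‖ := by
    intro z hz
    have := Convex.norm_image_sub_le_of_norm_hasDerivWithin_le (f := fun w => h w - deriv h p * (w - p))
      (f' := fun w => deriv h w - deriv h p * 1) (s := closedBall p (t/6)) (C := D/2) (x := p) (y := z)
      (by
        intro w hw
        have hw' := hsub hw
        have e1 : HasDerivAt h (deriv h w) w :=
          (hh.differentiableAt (isOpen_ball.mem_nhds hw')).hasDerivAt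
        exact (e1.sub (((hasDerivAt_id w).sub_const p).const_mul _)).hasDerivWithinAt)
      (by
        intro w hw
        have := h1 w (hsub hw)
        rw [mem_closedBall, dist_eq_norm] at hw
        rw [mul_one]
        calc _ ≤ _ := this
          _ ≤ 3 * D / t * (t/6) := by gcongr
          _ = D/2 := by field_simp; norm_num)
      (convex_closedBall _ _) (mem_closedBall_self (by positivity)) hz
    simp only [sub_self, mul_zero, sub_zero] at this
    rw [sub_right_comm]
    exact this
  have h3 : DiffContOnCl ℂ h (ball p (t/6)) := by
    apply DifferentiableOn.diffContOnCl
    rw [closure_ball _ (by positivity)]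
    exact hh.mono hsub
  have h4 := h3.ball_subset_image_closedBall (ε := D * t / 12) (by positivity) (by
      intro z hz
      have hz' := sphere_subset_closedBall hz
      have e := h2 z hz'
      rw [mem_sphere, dist_eq_norm] at hz
      have e2 : ‖deriv h p * (z - p)‖ ≤ ‖h z - h p‖ + ‖h z - h p - deriv h p * (z - p)‖ := by
        have := norm_sub_le (h z - h p) (h z - h p - deriv h p * (z - p))
        simpa using this
      rw [norm_mul, hz] at e2
      rw [hz] at e
      rw [← hDdef] at e2
      nlinarith) (by
      have := (hh.differentiableAt (ball_mem_nhds p ht)).hasDerivAt.eventually_ne (c := h p) hD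
      exact this.frequently.filter_mono nhdsWithin_le_nhds)
  convert h4 using 2
  ring

lemma bloch_bound {h : ℂ → ℂ} {a : ℂ} {r : ℝ} (hr : 0 < r) (hh : DifferentiableOn ℂ h (ball a r))
    (hom : ∀ w : ℂ, ∃ v ∈ ball w 2, ∀ z ∈ ball a r, h z ≠ v) :
    ∀ z ∈ closedBall a (r/2), ‖h z - h a‖ ≤ 192 := by
  have hd : DifferentiableOn ℂ (deriv h) (ball a r) := hh.deriv isOpen_ball
  have hsub : closedBall a (3*r/4) ⊆ ball a r := closedBall_subset_ball (by linarith)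
  obtain ⟨p, hp, hmax⟩ := (isCompact_closedBall a (3*r/4)).exists_isMaxOn
    (nonempty_closedBall.2 (by positivity))
    (f := fun z => (3*r/4 - ‖z - a‖) * ‖deriv h z‖)
    (by
      have := hd.continuousOn.mono hsub
      fun_prop)
  set M := (3*r/4 - ‖p - a‖) * ‖deriv h p‖ with hM
  have hmax' : ∀ z ∈ closedBall a (3*r/4), (3*r/4 - ‖z - a‖) * ‖deriv h z‖ ≤ M := hmax
  have hM96 : M ≤ 96 := by
    by_contra! hlt
    have hp1 : ‖p - a‖ ≤ 3*r/4 := by simpa [dist_eq_norm] using hp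
    have hD : deriv h p ≠ 0 := by
      intro h0
      rw [h0] at hM; simp at hM; linarith
    set t := (3*r/4 - ‖p - a‖)/2 with ht
    have ht0 : 0 < t := by
      rcases hp1.lt_or_eq with h1 | h1
      · rw [ht]; linarith
      · rw [h1] at hM; simp at hM; linarith
    have hballs : ball p t ⊆ closedBall a (3*r/4) := by
      intro z hz
      rw [mem_ball, dist_eq_norm] at hz
      rw [mem_closedBall, dist_eq_norm]
      have : ‖z - a‖ ≤ ‖z - p‖ + ‖p - a‖ := by simpa using norm_add_le (z-p) (p-a)
      linarith
    have := local_cover ht0 (hh.mono (hballs.trans hsub)) hD (by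
      intro z hz
      have h1 := hmax' z (hballs hz)
      rw [mem_ball, dist_eq_norm] at hz
      have : ‖z - a‖ ≤ ‖z - p‖ + ‖p - a‖ := by simpa using norm_add_le (z-p) (p-a)
      have h2 : t * ‖deriv h z‖ ≤ t * (2 * ‖deriv h p‖) := by
        calc _ ≤ (3*r/4 - ‖z - a‖) * ‖deriv h z‖ := by gcongr; linarith
          _ ≤ M := h1
          _ = _ := by rw [hM, ht]; ring
      exact le_of_mul_le_mul_left h2 ht0)
    obtain ⟨v, hv, hv'⟩ := hom (h p)
    have hb2 : ball (h p) 2 ⊆ ball (h p) (‖deriv h p‖ * t / 24) := by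
      apply ball_subset_ball
      have : M = 2 * t * ‖deriv h p‖ := by rw [hM, ht]; ring
      linarith
    obtain ⟨z, hz, hzv⟩ := this (hb2 hv)
    refine hv' z (hsub (hballs (closedBall_subset_ball (by linarith) hz))) hzv
  intro z hz
  have hsub2 : closedBall a (r/2) ⊆ closedBall a (3*r/4) := closedBall_subset_closedBall (by linarith)
  have := Convex.norm_image_sub_le_of_norm_deriv_le (f := h) (s := closedBall a (r/2)) (C := 96 / (r/4))
    (x := a) (y := z)
    (fun w hw => hh.differentiableAt (isOpen_ball.mem_nhds (hsub (hsub2 hw))))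
    (fun w hw => by
      have h1 := hmax' w (hsub2 hw)
      rw [mem_closedBall, dist_eq_norm] at hw
      rw [le_div_iff₀ (by positivity)]
      have : ‖deriv h w‖ * (r/4) ≤ ‖deriv h w‖ * (3*r/4 - ‖w - a‖) := by
        gcongr; linarith
      linarith)
    (convex_closedBall _ _) (mem_closedBall_self (by positivity)) hz
  rw [mem_closedBall, dist_eq_norm] at hz
  calc _ ≤ _ := this
    _ ≤ 96 / (r/4) * (r/2) := by gcongr
    _ = 192 := by field_simp; norm_num


lemma holo_log {q : ℂ → ℂ} {a : ℂ} {r : ℝ} (hr : 0 < r) (hq : DifferentiableOn ℂ q (ball a r))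
    (h0 : ∀ z ∈ ball a r, q z ≠ 0) :
    ∃ l : ℂ → ℂ, DifferentiableOn ℂ l (ball a r) ∧ (∀ z ∈ ball a r, exp (l z) = q z) ∧
      l a = log (q a) := by
  have hex : Complex.IsExactOn (fun z => deriv q z / q z) (ball a r) :=
    DifferentiableOn.isExactOn_ball ((hq.deriv isOpen_ball).div hq h0)
  obtain ⟨l, hla, hl⟩ := hex.with_val_at a (log (q a))
  have hc : a ∈ ball a r := mem_ball_self hr
  refine ⟨l, fun z hz => (hl z hz).differentiableAt.differentiableWithinAt, ?_, hla⟩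
  intro z hz
  have hder : ∀ w ∈ ball a r, HasDerivAt (fun w => q w * exp (- l w)) 0 w := by
    intro w hw
    have e1 := (hq.differentiableAt (isOpen_ball.mem_nhds hw)).hasDerivAt
    have e2 := (hl w hw).neg.cexp
    refine (e1.mul e2).congr_deriv ?_
    have := h0 w hw
    field_simp
    simp
  have := Convex.norm_image_sub_le_of_norm_hasDerivWithin_le (C := 0)
    (fun w hw => (hder w hw).hasDerivWithinAt) (by simp) (convex_ball a r) hc hz
  simp only [zero_mul, norm_le_zero_iff, sub_eq_zero] at this
  rw [hla, exp_neg, exp_neg, exp_log (h0 a hc), mul_inv_cancel₀ (h0 a hc)] at this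
  have h2 := exp_ne_zero (l z)
  field_simp at this
  exact this.symm

lemma cos_lift {u : ℂ → ℂ} {a : ℂ} {r : ℝ} (hr : 0 < r) (hu : DifferentiableOn ℂ u (ball a r))
    (h1 : ∀ z ∈ ball a r, u z ≠ 1) (h2 : ∀ z ∈ ball a r, u z ≠ -1) :
    ∃ v : ℂ → ℂ, DifferentiableOn ℂ v (ball a r) ∧ (∀ z ∈ ball a r, u z = cos (Real.pi * v z)) ∧
      |(v a).re| ≤ 1 := by
  obtain ⟨L, hL, hLe, -⟩ := holo_log hr (q := fun z => 1 - u z ^ 2) (by fun_prop) (by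
    intro z hz h
    have : (1 - u z) * (1 + u z) = 0 := by linear_combination h
    rcases mul_eq_zero.1 this with h | h
    · exact h1 z hz (by linear_combination -h)
    · exact h2 z hz (by linear_combination h))
  set s := fun z => exp (L z / 2) with hs
  have hs2 : ∀ z ∈ ball a r, s z ^ 2 = 1 - u z ^ 2 := by
    intro z hz
    rw [← hLe z hz, hs, ← exp_nat_mul]; congr 1; push_cast; ring
  have hsd : DifferentiableOn ℂ s (ball a r) := by
    intro z hz
    have := hL z hz
    exact (this.div_const 2).cexp
  have hprod : ∀ z ∈ ball a r, (u z + I * s z) * (u z - I * s z) = 1 := by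
    intro z hz
    have := hs2 z hz
    have hI := I_sq
    linear_combination this - (s z)^2 * hI
  obtain ⟨l, hl, hle, hla⟩ := holo_log hr (q := fun z => u z + I * s z) (by fun_prop) (by
    intro z hz h
    have := hprod z hz
    rw [h, zero_mul] at this
    exact zero_ne_one this)
  have hpi : (Real.pi : ℂ) ≠ 0 := by exact_mod_cast Real.pi_ne_zero
  refine ⟨fun z => l z / (I * Real.pi), by fun_prop, ?_, ?_⟩
  · intro z hz
    have e1 : (Real.pi : ℂ) * (l z / (I * Real.pi)) * I = l z := by
      field_simp [I_ne_zero]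
    have e2 := hle z hz
    have e3 : exp (-l z) = u z - I * s z := by
      rw [exp_neg, e2]; exact inv_eq_of_mul_eq_one_right (hprod z hz)
    rw [cos, neg_mul, e1, e2, e3]; ring
  · have : l a / (I * Real.pi) = (-I * l a) / (Real.pi : ℝ) := by
      field_simp [I_ne_zero]; linear_combination (l a) * I_sq
    simp only [this]
    rw [div_ofReal_re, hla]
    simp only [neg_mul, neg_re, mul_re, I_re, I_im, zero_mul, one_mul, zero_sub, neg_neg, log_im]
    rw [abs_div, abs_of_pos Real.pi_pos, div_le_one Real.pi_pos]
    exact abs_arg_le_pi _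

lemma norm_cos_le (w : ℂ) : ‖cos w‖ ≤ Real.exp |w.im| := by
  rw [cos, norm_div]
  have h1 : ‖exp (w * I)‖ ≤ Real.exp |w.im| := by
    rw [norm_exp]; apply Real.exp_le_exp.2; simp; exact neg_le_abs _
  have h2 : ‖exp (-w * I)‖ ≤ Real.exp |w.im| := by
    rw [norm_exp]; apply Real.exp_le_exp.2; simp; exact le_abs_self _
  have := norm_add_le (exp (w * I)) (exp (-w * I))
  simp only [Complex.norm_ofNat]
  linarith

lemma le_norm_cos (w : ℂ) : Real.exp |w.im| ≤ 1 + 2 * ‖cos w‖ := by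
  have h1 : ‖exp (w * I)‖ = Real.exp (-w.im) := by
    rw [norm_exp]; simp
  have h2 : ‖exp (-w * I)‖ = Real.exp (w.im) := by
    rw [norm_exp]; simp
  have h3 : exp (w * I) + exp (-w * I) = 2 * cos w := by rw [cos]; ring
  have h4 := norm_sub_le (2 * cos w) (exp (w * I))
  have h5 := norm_sub_le (2 * cos w) (exp (-w * I))
  rw [← h3] at h4 h5
  simp only [add_sub_cancel_left, add_sub_cancel_right] at h4 h5
  rw [h3, h1, h2] at h4
  rw [h3, h1, h2] at h5
  simp only [norm_mul, Complex.norm_ofNat] at h4 h5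
  rcases abs_cases w.im with ⟨h, h'⟩ | ⟨h, h'⟩ <;> rw [h]
  · have : Real.exp (-w.im) ≤ 1 := Real.exp_le_one_iff.2 (by linarith)
    linarith
  · have : Real.exp (w.im) ≤ 1 := Real.exp_le_one_iff.2 (by linarith)
    linarith

lemma cosh_int {y : ℝ} (hy : 0 ≤ y) : ∃ τ ∈ Icc y (y+1), ∃ N : ℤ, Real.cosh (Real.pi * τ) = N := by
  have h1 : (Real.cosh (Real.pi * y)) + 1 ≤ Real.cosh (Real.pi * (y+1)) := by
    rw [mul_add, mul_one, Real.cosh_add]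
    have e1 : 0 ≤ Real.sinh (Real.pi * y) * Real.sinh Real.pi := by
      apply mul_nonneg
      · exact Real.sinh_nonneg_iff.2 (by positivity)
      · exact Real.sinh_nonneg_iff.2 (by positivity)
    have e2 : 2 ≤ Real.cosh Real.pi := by
      rw [Real.cosh_eq]
      have := Real.add_one_le_exp Real.pi
      have := Real.exp_pos (-Real.pi)
      have := Real.pi_gt_three
      linarith
    have e3 := Real.one_le_cosh (Real.pi * y)
    nlinarith
  have := intermediate_value_Icc (f := fun τ => Real.cosh (Real.pi * τ)) (a := y) (b := y+1)
    (by linarith) (by fun_prop)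
  have hm : ((⌈Real.cosh (Real.pi * y)⌉ : ℤ) : ℝ) ∈ Icc (Real.cosh (Real.pi * y)) (Real.cosh (Real.pi * (y+1))) :=
    ⟨Int.le_ceil _, by have := Int.ceil_lt_add_one (Real.cosh (Real.pi * y)); linarith⟩
  obtain ⟨τ, hτ, h⟩ := this hm
  exact ⟨τ, hτ, _, h⟩

lemma cos_int_pm (N : ℤ) : Real.cos (N * Real.pi) = 1 ∨ Real.cos (N * Real.pi) = -1 := by
  have := Real.sin_sq_add_cos_sq (N * Real.pi)
  rw [Real.sin_int_mul_pi] at this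
  have h : (Real.cos (N * Real.pi) - 1) * (Real.cos (N * Real.pi) + 1) = 0 := by linarith
  rcases mul_eq_zero.1 h with h | h
  · left; linarith
  · right; linarith

lemma cos_int_dense (w : ℂ) : ∃ v ∈ ball w 2, ∃ N : ℤ, cos (Real.pi * v) = N := by
  obtain ⟨τ, hτ, N, hN⟩ := cosh_int (abs_nonneg w.im)
  have key : ∀ σ : ℝ, |σ| = τ → |σ - w.im| ≤ 1 → ∃ v ∈ ball w 2, ∃ N : ℤ, cos (Real.pi * v) = N := by
    intro σ h1 h2
    set m := round w.re
    refine ⟨⟨m, σ⟩, ?_, ?_⟩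
    · rw [mem_ball, dist_eq_norm]
      have := norm_le_abs_re_add_abs_im ((⟨m, σ⟩ : ℂ) - w)
      have h3 := abs_sub_round w.re
      rw [abs_sub_comm] at h3
      simp only [sub_re, sub_im] at this
      linarith
    · have e : (Real.pi : ℂ) * (⟨m, σ⟩ : ℂ) = ((m * Real.pi : ℝ) : ℂ) + ((Real.pi * σ : ℝ) : ℂ) * I := by
        apply Complex.ext <;> simp [mul_comm]
      rw [e, cos_add_mul_I, ← ofReal_cosh, ← Real.cosh_abs, abs_mul, h1, abs_of_pos Real.pi_pos, hN,
        ← ofReal_cos, ← ofReal_sin, Real.sin_int_mul_pi]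
      rcases cos_int_pm m with h | h <;> rw [h]
      · exact ⟨N, by simp⟩
      · exact ⟨-N, by simp⟩
  rcases abs_cases w.im with ⟨h, h'⟩ | ⟨h, h'⟩ <;> rw [h] at hτ
  · exact key τ (abs_of_nonneg (h'.trans hτ.1)) (abs_le.2 ⟨by linarith [hτ.1], by linarith [hτ.2]⟩)
  · refine key (-τ) (by rw [abs_neg]; exact abs_of_nonneg (by linarith [hτ.1])) (abs_le.2 ⟨by linarith [hτ.2], by linarith [hτ.1]⟩)

lemma schottky : ∃ p : ℕ, ∀ (k : ℂ → ℂ) (a : ℂ) (r : ℝ), 0 < r → DifferentiableOn ℂ k (ball a r) →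
    (∀ z ∈ ball a r, k z ≠ 0 ∧ k z ≠ 1) → ∀ z ∈ closedBall a (r/2),
      1 + Real.log (1 + ‖k z‖) ≤ 2 ^ p * (1 + Real.log (1 + ‖k a‖)) := by
  set E := Real.exp (Real.pi * 192) with hE
  obtain ⟨p, hp⟩ := pow_unbounded_of_one_lt (2 + 28 * E) (one_lt_two)
  refine ⟨p, fun k a r hr hk hom z hz => ?_⟩
  obtain ⟨F, hF, hFe, hFa⟩ := cos_lift hr (u := fun z => 2 * k z - 1) (by fun_prop)
    (fun z hz h => (hom z hz).2 (by linear_combination h/2))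
    (fun z hz h => (hom z hz).1 (by linear_combination h/2))
  have hFZ : ∀ z ∈ ball a r, ∀ N : ℤ, F z ≠ N := by
    intro z hz N hN
    have h1 := hFe z hz
    rw [hN] at h1
    have h2 : cos (Real.pi * (N:ℂ)) = ((Real.cos (N * Real.pi) : ℝ) : ℂ) := by
      push_cast; rw [mul_comm]
    have h3 := cos_int_pm N
    rw [h2] at h1
    rcases h3 with h3 | h3 <;> rw [h3] at h1 <;> push_cast at h1
    · exact (hom z hz).2 (by linear_combination h1/2)
    · exact (hom z hz).1 (by linear_combination h1/2)
  obtain ⟨h, hh, hhe, -⟩ := cos_lift hr hF (fun z hz h => hFZ z hz 1 (by simpa using h))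
    (fun z hz h => hFZ z hz (-1) (by simpa using h))
  have hbl := bloch_bound hr hh (by
    intro w
    obtain ⟨v, hv, N, hN⟩ := cos_int_dense w
    refine ⟨v, hv, fun z hz hzv => hFZ z hz N ?_⟩
    rw [hhe z hz, hzv, hN]) z hz
  have hzb : z ∈ ball a r := closedBall_subset_ball (by linarith) hz
  have hab : a ∈ ball a r := mem_ball_self hr
  have b1 : ‖F z‖ ≤ E * (1 + 2 * ‖F a‖) := by
    have e1 : |((Real.pi:ℂ) * h z).im| ≤ Real.pi * 192 + |((Real.pi:ℂ) * h a).im| := by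
      simp only [im_ofReal_mul, abs_mul, abs_of_pos Real.pi_pos]
      rw [← mul_add]
      gcongr
      have := (abs_im_le_norm (h z - h a)).trans hbl
      rw [sub_im] at this
      have := abs_sub_abs_le_abs_sub (h z).im (h a).im
      linarith
    calc ‖F z‖ ≤ Real.exp |((Real.pi:ℂ) * h z).im| := by rw [hhe z hzb]; exact norm_cos_le _
      _ ≤ Real.exp (Real.pi * 192 + |((Real.pi:ℂ) * h a).im|) := Real.exp_le_exp.2 e1
      _ = E * Real.exp (|((Real.pi:ℂ) * h a).im|) := by rw [Real.exp_add]
      _ ≤ _ := by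
        gcongr
        rw [hhe a hab]; exact le_norm_cos _
  have hLa : 0 ≤ Real.log (1 + ‖k a‖) := Real.log_nonneg (by have := norm_nonneg (k a); linarith)
  have hl4 : Real.log 4 ≤ 2 := by
    rw [show (4:ℝ) = 2^2 by norm_num, Real.log_pow]
    have := Real.log_two_lt_d9; push_cast; linarith
  have b2 : ‖F a‖ ≤ 3 * (1 + Real.log (1 + ‖k a‖)) := by
    have e1 := le_norm_cos ((Real.pi:ℂ) * F a)
    rw [← hFe a hab] at e1
    have e2 : ‖2 * k a - 1‖ ≤ 2 * ‖k a‖ + 1 := by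
      simpa using norm_sub_le (2 * k a) 1
    have e3 : |((Real.pi:ℂ) * F a).im| ≤ Real.log (4 * (1 + ‖k a‖)) := by
      rw [Real.le_log_iff_exp_le (by positivity)]; linarith
    rw [Real.log_mul (by norm_num) (by positivity)] at e3
    simp only [im_ofReal_mul, abs_mul, abs_of_pos Real.pi_pos] at e3
    have e4 := norm_le_abs_re_add_abs_im (F a)
    have e5 : |(F a).im| ≤ Real.pi * |(F a).im| := by
      have := Real.pi_gt_three
      have := abs_nonneg (F a).im
      nlinarith
    linarith
  have b3 : 1 + Real.log (1 + ‖k z‖) ≤ 2 + 4 * ‖F z‖ := by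
    have e1 := norm_cos_le ((Real.pi:ℂ) * F z)
    rw [← hFe z hzb] at e1
    simp only [im_ofReal_mul, abs_mul, abs_of_pos Real.pi_pos] at e1
    have e2 : 2 * ‖k z‖ ≤ ‖2 * k z - 1‖ + 1 := by
      simpa using norm_add_le (2 * k z - 1) 1
    have e3 : Real.exp (Real.pi * |(F z).im|) ≤ Real.exp (4 * ‖F z‖) := by
      apply Real.exp_le_exp.2
      have := Real.pi_lt_four
      exact mul_le_mul this.le (abs_im_le_norm _) (abs_nonneg _) (by norm_num)
    have e4 : 1 ≤ Real.exp (4 * ‖F z‖) := Real.one_le_exp (by positivity)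
    have e5 : 1 + ‖k z‖ ≤ Real.exp 1 * Real.exp (4 * ‖F z‖) := by
      have := Real.add_one_le_exp (1:ℝ)
      nlinarith
    rw [← Real.exp_add] at e5
    have := Real.log_le_log (by positivity) e5
    rw [Real.log_exp] at this
    linarith
  have hE0 : 0 < E := Real.exp_pos _
  calc _ ≤ 2 + 4 * (E * (1 + 2 * (3 * (1 + Real.log (1 + ‖k a‖))))) := by
        refine b3.trans ?_
        gcongr
        refine b1.trans ?_
        gcongr
    _ ≤ (2 + 28 * E) * (1 + Real.log (1 + ‖k a‖)) := by nlinarith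
    _ ≤ _ := by gcongr


/-- logarithmic size -/
noncomputable def Lam (w : ℂ) : ℝ := 1 + Real.log (1 + ‖w‖)

lemma one_le_Lam (w : ℂ) : 1 ≤ Lam w := by
  have : 0 ≤ Real.log (1 + ‖w‖) := Real.log_nonneg (by have := norm_nonneg w; linarith)
  unfold Lam; linarith

lemma Lam_le_of_norm_le {w : ℂ} {M : ℝ} (h : ‖w‖ ≤ M) : Lam w ≤ 1 + Real.log (1 + M) := by
  unfold Lam
  have := norm_nonneg w
  gcongr

lemma norm_le_of_Lam_le {w : ℂ} {M : ℝ} (h : Lam w ≤ M) : ‖w‖ ≤ Real.exp M := by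
  unfold Lam at h
  have h1 : Real.log (1 + ‖w‖) ≤ M := by linarith
  rw [Real.log_le_iff_le_exp (by positivity)] at h1
  linarith

lemma schottky' : ∃ p : ℕ, ∀ (k : ℂ → ℂ) (a : ℂ) (r : ℝ), 0 < r → DifferentiableOn ℂ k (ball a r) →
    (∀ z ∈ ball a r, k z ≠ 0 ∧ k z ≠ 1) → ∀ z ∈ closedBall a (r/2),
      Lam (k z) ≤ 2 ^ p * Lam (k a) := schottky

lemma picard {F : ℂ → ℂ} (hF : Differentiable ℂ F) {a b : ℂ} (hab : a ≠ b) (ha : ∀ z, F z ≠ a)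
    (hb : ∀ z, F z ≠ b) (z w : ℂ) : F z = F w := by
  obtain ⟨p, hp⟩ := schottky'
  set k : ℂ → ℂ := fun z => (F z - a) / (b - a) with hk
  have hba : b - a ≠ 0 := sub_ne_zero.2 hab.symm
  have hkd : Differentiable ℂ k := by fun_prop
  have hb' : ∀ z, ‖k z‖ ≤ Real.exp (2 ^ p * Lam (k 0)) := by
    intro z
    apply norm_le_of_Lam_le
    apply hp k 0 (2 * (‖z‖ + 1)) (by positivity) hkd.differentiableOn
    · intro z _
      constructor
      · exact div_ne_zero (sub_ne_zero.2 (ha z)) hba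
      · intro h
        rw [hk, div_eq_one_iff_eq hba] at h
        exact hb z (by linear_combination h)
    · simp
  have := hkd.apply_eq_apply_of_bounded (isBounded_iff_forall_norm_le.2
    ⟨_, by rintro _ ⟨z, rfl⟩; exact hb' z⟩) z w
  simp only [hk] at this
  rw [div_left_inj' hba] at this
  linear_combination this

lemma dichotomy {φ : ℂ → ℂ} {p : ℂ} {r K : ℝ} (hr : 0 < r) (hK : 0 ≤ K)
    (hφ : DifferentiableOn ℂ φ (ball p r))
    (hb : ∀ z ∈ ball p r, ‖deriv φ z‖ ≤ K * (1 + ‖φ z‖^2)) (hKr : 10 * K * r < 1) 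
    {x : ℂ} (hx : x ∈ ball p r) (hx1 : ‖φ x‖ ≤ 1) {y : ℂ} (hy : y ∈ ball p r) : ‖φ y‖ ≤ 2 := by
  have hseg : ∀ t ∈ Icc (0:ℝ) 1, x + (t:ℂ) * (y - x) ∈ ball p r := by
    intro t ht
    have := (convex_ball p r).add_smul_sub_mem hx hy ht
    simpa using this
  have hder : ∀ t ∈ Icc (0:ℝ) 1, HasDerivAt (fun t : ℝ => φ (x + (t:ℂ) * (y - x)))
      (deriv φ (x + (t:ℂ) * (y - x)) * (y - x)) t := by
    intro t ht
    have e1 := (hφ.differentiableAt (isOpen_ball.mem_nhds (hseg t ht))).hasDerivAt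
    have e2 : HasDerivAt (fun s : ℂ => x + s * (y - x)) (y - x) (t:ℂ) := by
      simpa using ((hasDerivAt_id (t:ℂ)).mul_const (y - x)).const_add x
    exact (HasDerivAt.comp (t:ℂ) e1 e2).comp_ofReal
  have hyx : ‖y - x‖ ≤ 2 * r := by
    rw [mem_ball] at hx hy
    rw [← dist_eq_norm]
    have := dist_triangle_right y x p
    linarith
  have := image_norm_le_of_norm_deriv_right_lt_deriv_boundary
    (f := (fun t : ℝ => φ (x + (t:ℂ) * (y - x)))) (a := 0) (b := 1)
    (f' := fun t : ℝ => deriv φ (x + (t:ℂ) * (y - x)) * (y - x))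
    (B := fun t => 1 + t) (B' := fun _ => 1)
    (fun t ht => (hder t ht).continuousAt.continuousWithinAt)
    (fun t ht => (hder t ⟨ht.1, ht.2.le⟩).hasDerivWithinAt) (by simpa using hx1)
    (fun t => by simpa using (hasDerivAt_id t).const_add 1) (by
      intro t ht hB
      have h1 := hb _ (hseg t ⟨ht.1, ht.2.le⟩)
      rw [hB] at h1
      rw [norm_mul]
      calc _ ≤ (K * (1 + (1 + t)^2)) * (2 * r) := by gcongr
        _ ≤ (K * (1 + (1 + 1)^2)) * (2 * r) := by
          have := ht.1
          have := ht.2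
          gcongr
        _ < 1 := by linarith)
    (x := 1) ⟨by norm_num, le_rfl⟩
  simp at this
  linarith

/-- local comparability of logarithmic sizes -/
def NProp (l : Filter ℕ) (φ : ℕ → ℂ → ℂ) (p : ℂ) : Prop :=
  ∃ r > 0, ∃ C : ℝ, ∀ᶠ n in l, ∀ x ∈ ball p r, ∀ y ∈ ball p r, Lam (φ n y) ≤ C * Lam (φ n x)

/-- local boundedness at a point -/
def LBdd (l : Filter ℕ) (φ : ℕ → ℂ → ℂ) (p : ℂ) : Prop :=
  ∃ r > 0, ∃ M : ℝ, ∀ᶠ n in l, ∀ x ∈ ball p r, ‖φ n x‖ ≤ M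

lemma nprop_of_sharp {l : Filter ℕ} {φ : ℕ → ℂ → ℂ} {p : ℂ} {r K : ℝ} (hr : 0 < r)
    (hφ : ∀ᶠ n in l, DifferentiableOn ℂ (φ n) (ball p r))
    (hb : ∀ᶠ n in l, ∀ z ∈ ball p r, ‖deriv (φ n) z‖ ≤ K * (1 + ‖φ n z‖^2)) : NProp l φ p := by
  obtain ⟨P, hP⟩ := schottky'
  set ρ := min r (1 / (20 * (|K| + 1))) with hρ
  have hρ0 : 0 < ρ := by positivity
  have hρr : ρ ≤ r := min_le_left _ _
  have hρK : 10 * |K| * ρ < 1 := by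
    have h1 : ρ ≤ 1 / (20 * (|K| + 1)) := min_le_right _ _
    have h2 : 0 ≤ |K| := abs_nonneg K
    rw [le_div_iff₀ (by positivity)] at h1
    nlinarith
  refine ⟨ρ / 8, by positivity, 2 ^ P + 3, ?_⟩
  filter_upwards [hφ, hb] with n hd hbn x hx y hy
  have hsub : ball p ρ ⊆ ball p r := ball_subset_ball hρr
  have hs8 : ball p (ρ/8) ⊆ ball p ρ := ball_subset_ball (by linarith)
  have hLx := one_le_Lam (φ n x)
  have h2P : (0:ℝ) < 2 ^ P := by positivity
  by_cases hc : ∃ z ∈ ball p ρ, ‖φ n z‖ ≤ 1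
  · obtain ⟨z, hz, hz1⟩ := hc
    have := dichotomy hρ0 (abs_nonneg K) (hd.mono hsub) (fun z hz => (hbn z (hsub hz)).trans
      (by gcongr; exact le_abs_self K)) hρK hz hz1 (hs8 hy)
    have h3 := Lam_le_of_norm_le this
    have : Real.log (1 + 2) ≤ 2 := by
      have := Real.log_le_sub_one_of_pos (x := 1 + 2) (by norm_num)
      linarith
    nlinarith
  · push Not at hc
    rw [mem_ball] at hx hy
    have hsx : ball x (ρ/2) ⊆ ball p ρ := by
      apply ball_subset_ball'
      linarith
    have := hP (φ n) x (ρ/2) (by positivity) (hd.mono (hsx.trans hsub)) (by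
      intro z hz
      have := hc z (hsx hz)
      constructor
      · intro h; rw [h] at this; simp at this; linarith
      · intro h; rw [h] at this; simp at this) y (by
      rw [mem_closedBall]
      have := dist_triangle_right y x p
      linarith)
    nlinarith

lemma NProp.lbdd_of_point {l : Filter ℕ} {φ : ℕ → ℂ → ℂ} {p : ℂ} {r C : ℝ} 
    (hr : 0 < r) (h : ∀ᶠ n in l, ∀ x ∈ ball p r, ∀ y ∈ ball p r, Lam (φ n y) ≤ C * Lam (φ n x))
    {x : ℂ} (hx : x ∈ ball p r) {M : ℝ} (hM : ∀ᶠ n in l, ‖φ n x‖ ≤ M) : LBdd l φ p := by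
  refine ⟨r, hr, Real.exp (|C| * (1 + Real.log (1 + M))), ?_⟩
  filter_upwards [h, hM] with n hn hnM y hy
  apply norm_le_of_Lam_le
  refine (hn x hx y hy).trans ?_
  have := Lam_le_of_norm_le hnM
  have h1 := one_le_Lam (φ n x)
  exact mul_le_mul (le_abs_self C) this (by linarith) (abs_nonneg C)

lemma NProp.lbdd {l : Filter ℕ} {φ : ℕ → ℂ → ℂ} {p : ℂ} (h : NProp l φ p)
    {M : ℝ} (hM : ∀ᶠ n in l, ‖φ n p‖ ≤ M) : LBdd l φ p := by
  obtain ⟨r, hr, C, hC⟩ := h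
  exact NProp.lbdd_of_point hr hC (mem_ball_self hr) hM

lemma isOpen_lbdd (l : Filter ℕ) (φ : ℕ → ℂ → ℂ) : IsOpen {p | LBdd l φ p} := by
  rw [Metric.isOpen_iff]
  rintro p ⟨r, hr, M, h⟩
  refine ⟨r, hr, fun q hq => ?_⟩
  rw [mem_ball] at hq
  refine ⟨r - dist q p, by linarith, M, ?_⟩
  filter_upwards [h] with n hn x hx
  exact hn x (ball_subset_ball' (by linarith) hx)

lemma lbdd_of_preconnected {l : Filter ℕ} {φ : ℕ → ℂ → ℂ} {S : Set ℂ} (hS : IsPreconnected S)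
    (hN : ∀ p ∈ S, NProp l φ p) (hne : ∃ p ∈ S, LBdd l φ p) : ∀ p ∈ S, LBdd l φ p := by
  obtain ⟨q, hq, hqb⟩ := hne
  refine hS.subset_of_closure_inter_subset (u := {p | LBdd l φ p}) (isOpen_lbdd l φ) ⟨q, hq, hqb⟩ ?_
  intro p hp'
  have hp : p ∈ closure {p | LBdd l φ p} := hp'.1
  have hpS := hp'.2
  change LBdd l φ p
  obtain ⟨r, hr, C, hC⟩ := hN p hpS
  rw [Metric.mem_closure_iff] at hp
  obtain ⟨x, ⟨r', hr', M, hx⟩, hxp⟩ := hp r hr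
  refine NProp.lbdd_of_point hr hC (x := x) (by rwa [mem_ball, dist_comm]) (M := M) ?_
  filter_upwards [hx] with n hn using hn x (mem_ball_self hr')

lemma bdd_of_compact {l : Filter ℕ} {φ : ℕ → ℂ → ℂ} {S : Set ℂ} (hS : IsCompact S)
    (h : ∀ p ∈ S, LBdd l φ p) : ∃ M : ℝ, ∀ᶠ n in l, ∀ x ∈ S, ‖φ n x‖ ≤ M := by
  refine hS.induction_on (p := fun S => ∃ M : ℝ, ∀ᶠ n in l, ∀ x ∈ S, ‖φ n x‖ ≤ M) ⟨0, by simp⟩ ?_ ?_ ?_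
  · rintro s t hst ⟨M, hM⟩
    exact ⟨M, hM.mono fun n hn x hx => hn x (hst hx)⟩
  · rintro s t ⟨M, hM⟩ ⟨M', hM'⟩
    refine ⟨max M M', ?_⟩
    filter_upwards [hM, hM'] with n h1 h2 x hx
    rcases hx with hx | hx
    · exact (h1 x hx).trans (le_max_left _ _)
    · exact (h2 x hx).trans (le_max_right _ _)
  · intro x hx
    obtain ⟨r, hr, M, hM⟩ := h x hx
    exact ⟨ball x r, mem_nhdsWithin_of_mem_nhds (ball_mem_nhds x hr), M, hM⟩

lemma lip_of_bdd {φ : ℂ → ℂ} {p : ℂ} {r M : ℝ} (hr : 0 < r) (hφ : DifferentiableOn ℂ φ (ball p r))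
    (hM : ∀ x ∈ ball p r, ‖φ x‖ ≤ M) : ∀ x ∈ ball p (r/2), ∀ y ∈ ball p (r/2),
      ‖φ y - φ x‖ ≤ M / (r/4) * ‖y - x‖ := by
  intro x hx y hy
  refine Convex.norm_image_sub_le_of_norm_deriv_le (s := ball p (r/2)) ?_ ?_ (convex_ball _ _) hx hy
  · intro z hz
    exact hφ.differentiableAt (isOpen_ball.mem_nhds (ball_subset_ball (by linarith) hz))
  · intro z hz
    have hsub : closedBall z (r/4) ⊆ ball p r := by
      rw [mem_ball] at hz
      apply closedBall_subset_ball'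
      linarith
    apply Complex.norm_deriv_le_of_forall_mem_sphere_norm_le (by positivity)
    · apply DifferentiableOn.diffContOnCl
      rw [closure_ball _ (by positivity)]
      exact hφ.mono hsub
    · intro w hw
      exact hM w (hsub (sphere_subset_closedBall hw))

lemma ultra_montel {𝒰 : Ultrafilter ℕ} {φ : ℕ → ℂ → ℂ} {U : Set ℂ} 
    (hφ : ∀ n, Differentiable ℂ (φ n)) (h : ∀ p ∈ U, LBdd 𝒰 φ p) :
    ∃ Φ : ℂ → ℂ, TendstoLocallyUniformlyOn φ Φ 𝒰 U := by
  have hpt : ∀ p, ∃ L, p ∈ U → Tendsto (fun n => φ n p) 𝒰 (𝓝 L) := by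
    intro p
    by_cases hp : p ∈ U
    · obtain ⟨r, hr, M, hM⟩ := h p hp
      have := (isCompact_closedBall (0:ℂ) M).ultrafilter_le_nhds (𝒰.map (fun n => φ n p)) (by
        rw [Filter.le_principal_iff]
        show ∀ᶠ n in (𝒰 : Filter ℕ), φ n p ∈ closedBall 0 M
        filter_upwards [hM] with n hn
        simpa using hn p (mem_ball_self hr))
      obtain ⟨L, -, hL⟩ := this
      exact ⟨L, fun _ => hL⟩
    · exact ⟨0, fun h => absurd h hp⟩
  choose Φ hΦ using hpt
  refine ⟨Φ, ?_⟩
  rw [Metric.tendstoLocallyUniformlyOn_iff]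
  intro ε hε p hp
  obtain ⟨r, hr, M, hM⟩ := h p hp
  set L := |M| / (r/4) + 1 with hL
  have hL0 : 0 < L := by positivity
  have hlip : ∀ᶠ n in (𝒰 : Filter ℕ), ∀ x ∈ ball p (r/2), ∀ y ∈ ball p (r/2), ‖φ n y - φ n x‖ ≤ L * ‖y - x‖ := by
    filter_upwards [hM] with n hn x hx y hy
    refine (lip_of_bdd hr (hφ n).differentiableOn (fun x hx => (hn x hx).trans (le_abs_self M)) x hx y hy).trans ?_
    gcongr
    linarith
  set δ := min (r/2) (ε / (4 * L)) with hδ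
  have hδ0 : 0 < δ := by positivity
  refine ⟨U ∩ ball p δ, inter_mem self_mem_nhdsWithin (mem_nhdsWithin_of_mem_nhds (ball_mem_nhds p hδ0)), ?_⟩
  have hsub : ball p δ ⊆ ball p (r/2) := ball_subset_ball (min_le_left _ _)
  have hpp : p ∈ ball p (r/2) := mem_ball_self (by positivity)
  have hlipΦ : ∀ y ∈ U ∩ ball p δ, ‖Φ y - Φ p‖ ≤ L * ‖y - p‖ := by
    intro y hy
    refine le_of_tendsto ((hΦ y hy.1).sub (hΦ p hp)).norm ?_
    filter_upwards [hlip] with n hn using hn p hpp y (hsub hy.2)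
  have hclose := Metric.tendsto_nhds.1 (hΦ p hp) (ε/4) (by positivity)
  filter_upwards [hlip, hclose] with n hn hc y hy
  have e1 := hlipΦ y hy
  have e2 := hn p hpp y (hsub hy.2)
  have e3 : L * ‖y - p‖ ≤ ε / 4 := by
    have := hy.2
    rw [mem_ball, dist_eq_norm] at this
    calc _ ≤ L * (ε / (4 * L)) := by
          gcongr
          exact this.le.trans (min_le_right _ _)
      _ = ε / 4 := by field_simp
  rw [dist_eq_norm] at hc ⊢
  calc ‖Φ y - φ n y‖ = ‖(Φ y - Φ p) - (φ n y - φ n p) - (φ n p - Φ p)‖ := by congr 1; ring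
    _ ≤ ‖Φ y - Φ p‖ + ‖φ n y - φ n p‖ + ‖φ n p - Φ p‖ := (norm_sub_le _ _).trans (by gcongr; exact norm_sub_le _ _)
    _ < ε := by linarith


/-- points of non-normality -/
def Spot (l : Filter ℕ) (f : ℕ → ℂ → ℂ) (p : ℂ) : Prop :=
  ∀ r > 0, ∀ K : ℝ, ∀ᶠ n in l, ∃ w ∈ ball p r, K * (1 + ‖f n w‖^2) < ‖deriv (f n) w‖

lemma nprop_of_not_spot {𝒰 : Ultrafilter ℕ} {f : ℕ → ℂ → ℂ} {p : ℂ} (hf : ∀ n, Differentiable ℂ (f n))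
    (h : ¬ Spot 𝒰 f p) : NProp 𝒰 f p := by
  unfold Spot at h
  push Not at h
  obtain ⟨r, hr, K, hK⟩ := h
  exact nprop_of_sharp hr (Eventually.of_forall fun n => (hf n).differentiableOn) hK

lemma deriv_rescale {f : ℂ → ℂ} (hf : Differentiable ℂ f) (w ρ ω : ℂ) :
    deriv (fun ω => f (w + ρ * ω)) ω = ρ * deriv f (w + ρ * ω) := by
  have e1 := (hf (w + ρ * ω)).hasDerivAt
  have e2 : HasDerivAt (fun s : ℂ => w + ρ * s) ρ ω := by
    simpa using ((hasDerivAt_id ω).const_mul ρ).const_add w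
  have e3 : HasDerivAt (fun ω => f (w + ρ * ω)) _ ω := HasDerivAt.comp ω e1 e2
  rw [e3.deriv, mul_comm]

lemma zoom1 {f : ℂ → ℂ} (hf : Differentiable ℂ f) (p : ℂ) {r : ℝ} (hr : 0 < r) :
    ∃ w ρ : ℂ, ∀ K > 0, (∃ w ∈ ball p r, K * (1 + ‖f w‖^2) < ‖deriv f w‖) →
      ‖deriv (fun ω => f (w + ρ * ω)) 0‖ = 1 + ‖f w‖^2 ∧
      ∀ ω, ‖ω‖ ≤ K * r / 2 → w + ρ * ω ∈ ball p (2*r) ∧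
        ‖deriv (fun ω => f (w + ρ * ω)) ω‖ ≤ 2 * (1 + ‖f (w + ρ * ω)‖^2) := by
  have hcd : Continuous (deriv f) := (hf.contDiff (n := 1)).continuous_deriv le_rfl
  have hcf := hf.continuous
  have hpos : ∀ z, 0 < 1 + ‖f z‖^2 := fun z => by positivity
  obtain ⟨w, hw, hmax⟩ := (isCompact_closedBall p (2*r)).exists_isMaxOn
    (nonempty_closedBall.2 (by positivity))
    (f := fun z => (2*r - ‖z - p‖) * (‖deriv f z‖ / (1 + ‖f z‖^2)))
    (by
      apply Continuous.continuousOn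
      have : Continuous fun z => ‖deriv f z‖ / (1 + ‖f z‖^2) :=
        Continuous.div (by fun_prop) (by fun_prop) (fun z => (hpos z).ne')
      fun_prop)
  set D := ‖deriv f w‖ / (1 + ‖f w‖^2) with hD
  have hmax' : ∀ z ∈ closedBall p (2*r), (2*r - ‖z - p‖) * (‖deriv f z‖ / (1 + ‖f z‖^2)) ≤ (2*r - ‖w - p‖) * D := hmax
  refine ⟨w, ((1/D : ℝ) : ℂ), ?_⟩
  rintro K hK ⟨q, hq, hqK⟩
  have hwp : ‖w - p‖ ≤ 2*r := by simpa [dist_eq_norm] using hw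
  have hM : K * r < (2*r - ‖w - p‖) * D := by
    have h1 := hmax' q (ball_subset_closedBall (ball_subset_ball (by linarith) hq))
    rw [mem_ball, dist_eq_norm] at hq
    have h2 : K < ‖deriv f q‖ / (1 + ‖f q‖^2) := by rwa [lt_div_iff₀ (hpos q)]
    have : K * r ≤ (2*r - ‖q - p‖) * (‖deriv f q‖ / (1 + ‖f q‖^2)) := by
      rw [mul_comm]
      exact mul_le_mul (by linarith) h2.le hK.le (by linarith)
    refine lt_of_lt_of_le ?_ h1
    have : r * K < (2*r - ‖q - p‖) * (‖deriv f q‖ / (1 + ‖f q‖^2)) :=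
      mul_lt_mul (by linarith) h2.le hK (by linarith)
    linarith
  have hKr : 0 < K * r := by positivity
  have hD0 : 0 < D := by
    by_contra! h
    have : (2*r - ‖w - p‖) * D ≤ 0 := mul_nonpos_of_nonneg_of_nonpos (by linarith) h
    linarith
  have hs0 : 0 < 2*r - ‖w - p‖ := by
    by_contra! h
    have : (2*r - ‖w - p‖) * D ≤ 0 := mul_nonpos_of_nonpos_of_nonneg h hD0.le
    linarith
  have hnρ : ‖((1/D : ℝ) : ℂ)‖ = 1/D := by rw [norm_real, Real.norm_of_nonneg (by positivity)]
  have hDw : ‖deriv f w‖ = D * (1 + ‖f w‖^2) := by rw [hD]; field_simp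
  constructor
  · rw [deriv_rescale hf, norm_mul, hnρ, mul_zero, add_zero, hDw]; field_simp
  · intro ω hω
    have h1 : ‖((1/D : ℝ) : ℂ) * ω‖ ≤ (2*r - ‖w - p‖)/2 := by
      rw [norm_mul, hnρ, one_div, inv_mul_le_iff₀ hD0]
      nlinarith
    set z := w + ((1/D : ℝ) : ℂ) * ω with hz
    have h2 : ‖z - p‖ ≤ ‖w - p‖ + (2*r - ‖w - p‖)/2 := by
      rw [hz, add_sub_right_comm]
      exact (norm_add_le _ _).trans (by gcongr)
    have h3 : z ∈ ball p (2*r) := by rw [mem_ball, dist_eq_norm]; linarith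
    refine ⟨h3, ?_⟩
    rw [deriv_rescale hf, norm_mul, hnρ, ← hz]
    have h4 := hmax' z (ball_subset_closedBall h3)
    have h5 : (2*r - ‖w - p‖)/2 * (‖deriv f z‖ / (1 + ‖f z‖^2)) ≤ (2*r - ‖w - p‖)/2 * (2 * D) := by
      calc _ ≤ (2*r - ‖z - p‖) * (‖deriv f z‖ / (1 + ‖f z‖^2)) := by
            gcongr; linarith
        _ ≤ _ := h4
        _ = _ := by ring
    have h6 := le_of_mul_le_mul_left h5 (by linarith)
    rw [div_le_iff₀ (hpos z)] at h6
    rw [one_div, inv_mul_le_iff₀ hD0]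
    linarith

lemma zoom {𝒰 : Ultrafilter ℕ} {f : ℕ → ℂ → ℂ} (hf : ∀ n, Differentiable ℂ (f n)) {p : ℂ}
    (hs : Spot 𝒰 f p) {r : ℝ} (hr : 0 < r) :
    ∃ (w ρ : ℕ → ℂ) (F : ℂ → ℂ), Differentiable ℂ F ∧ deriv F 0 ≠ 0 ∧
      TendstoLocallyUniformlyOn (fun n ω => f n (w n + ρ n * ω)) F 𝒰 univ ∧
      ∀ T : ℝ, ∀ᶠ n in (𝒰 : Filter ℕ), ∀ ω : ℂ, ‖ω‖ ≤ T → w n + ρ n * ω ∈ ball p (2*r) := by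
  choose w ρ hwρ using fun n => zoom1 (hf n) p hr
  set φ : ℕ → ℂ → ℂ := fun n ω => f n (w n + ρ n * ω) with hφ
  have hφd : ∀ n, Differentiable ℂ (φ n) := fun n => by
    have := hf n
    fun_prop
  have hev : ∀ T : ℝ, ∀ᶠ n in (𝒰 : Filter ℕ), ∀ ω : ℂ, ‖ω‖ ≤ T → w n + ρ n * ω ∈ ball p (2*r) ∧
      ‖deriv (φ n) ω‖ ≤ 2 * (1 + ‖φ n ω‖^2) := by
    intro T
    filter_upwards [hs r hr (2 * (|T| + 1) / r)] with n hn ω hω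
    refine (hwρ n _ (by positivity) hn).2 ω ?_
    have : 2 * (|T| + 1) / r * r / 2 = |T| + 1 := by field_simp
    rw [this]
    linarith [le_abs_self T]
  have h0 : ∀ᶠ n in (𝒰 : Filter ℕ), ‖deriv (φ n) 0‖ = 1 + ‖φ n 0‖^2 := by
    filter_upwards [hs r hr 1] with n hn
    have := (hwρ n 1 one_pos hn).1
    simpa [hφ] using this
  have hN : ∀ p, NProp 𝒰 φ p := by
    intro p
    refine nprop_of_sharp (r := 1) (K := 2) one_pos (Eventually.of_forall fun n => (hφd n).differentiableOn) ?_
    filter_upwards [hev (‖p‖ + 1)] with n hn z hz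
    refine (hn z ?_).2
    rw [mem_ball, dist_eq_norm] at hz
    have := norm_add_le (z - p) p
    simp only [sub_add_cancel] at this
    linarith
  have hb0 : ∃ M : ℝ, ∀ᶠ n in (𝒰 : Filter ℕ), ‖φ n 0‖ ≤ M := by
    by_contra! hcon
    obtain ⟨r0, hr0, C, hC⟩ := hN 0
    set N := 4 / r0 with hNdef
    have hN0 : 0 < N := by positivity
    have hfr : ∀ᶠ n in (𝒰 : Filter ℕ), _ < ‖φ n 0‖ := hcon (Real.exp (|C| * (1 + Real.log (1 + N))))
    obtain ⟨n, hn1, hn2, hn3⟩ := (hfr.and (hC.and h0)).exists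
    have hbig : ∀ x ∈ ball (0:ℂ) r0, N < ‖φ n x‖ := by
      intro x hx
      by_contra! hle
      have e1 := hn2 x hx 0 (mem_ball_self hr0)
      have e2 := Lam_le_of_norm_le hle
      have e3 := one_le_Lam (φ n x)
      have e4 : Lam (φ n 0) ≤ |C| * (1 + Real.log (1 + N)) :=
        e1.trans (mul_le_mul (le_abs_self C) e2 (by linarith) (abs_nonneg C))
      exact absurd (norm_le_of_Lam_le e4) (not_le.2 hn1)
    have hne : ∀ x ∈ ball (0:ℂ) r0, φ n x ≠ 0 := fun x hx h => by
      have := hbig x hx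
      rw [h, norm_zero] at this
      linarith
    have hsub : closedBall (0:ℂ) (r0/2) ⊆ ball 0 r0 := closedBall_subset_ball (by linarith)
    have hcauchy := Complex.norm_deriv_le_of_forall_mem_sphere_norm_le (f := fun x => (φ n x)⁻¹) (c := 0)
      (R := r0/2) (C := 1/N) (by positivity) (by
        apply DifferentiableOn.diffContOnCl
        rw [closure_ball _ (by positivity)]
        exact (hφd n).differentiableOn.inv (fun x hx => hne x (hsub hx))) (by
        intro x hx
        have := hbig x (hsub (sphere_subset_closedBall hx))
        rw [norm_inv, ← one_div]
        gcongr)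
    have h00 := hne 0 (mem_ball_self hr0)
    have hder : deriv (fun x => (φ n x)⁻¹) 0 = - deriv (φ n) 0 / (φ n 0)^2 :=
      ((hφd n 0).hasDerivAt.fun_inv h00).deriv
    rw [hder, norm_div, norm_neg, norm_pow, hn3, div_le_iff₀ (by positivity)] at hcauchy
    have : 1 / N / (r0/2) = 1/2 := by rw [hNdef]; field_simp; norm_num
    rw [this] at hcauchy
    nlinarith [norm_nonneg (φ n 0)]
  obtain ⟨M, hM⟩ := hb0
  have hL : ∀ p ∈ (univ : Set ℂ), LBdd 𝒰 φ p :=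
    lbdd_of_preconnected isPreconnected_univ (fun p _ => hN p) ⟨0, mem_univ _, (hN 0).lbdd hM⟩
  obtain ⟨F, hF⟩ := ultra_montel hφd hL
  have hFd : DifferentiableOn ℂ F univ :=
    hF.differentiableOn (Eventually.of_forall fun n => (hφd n).differentiableOn) isOpen_univ
  refine ⟨w, ρ, F, differentiableOn_univ.1 hFd, ?_, hF, fun T => (hev T).mono fun n hn ω hω => (hn ω hω).1⟩
  have hd := hF.deriv (Eventually.of_forall fun n => (hφd n).differentiableOn) isOpen_univ
  have hd0 := hd.tendsto_at (mem_univ (0:ℂ))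
  have : 1 ≤ ‖deriv F 0‖ := by
    refine ge_of_tendsto hd0.norm ?_
    filter_upwards [h0] with n hn
    simp only [Function.comp]
    rw [hn]
    nlinarith [sq_nonneg ‖φ n 0‖]
  intro h
  rw [h, norm_zero] at this
  linarith


lemma branches {l : Filter ℕ} [l.NeBot] {φ : ℕ → ℂ → ℂ} {F : ℂ → ℂ} (hφ : ∀ n, Differentiable ℂ (φ n))
    (hF : TendstoLocallyUniformlyOn φ F l univ) {ω₁ c : ℂ} (hc : F ω₁ = c) (hD : deriv F ω₁ ≠ 0) :
    ∃ δ > 0, ∀ᶠ n in l, ∃ ψ : ℂ → ℂ, DifferentiableOn ℂ ψ (ball c δ) ∧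
      ∀ ζ ∈ ball c δ, φ n (ψ ζ) = ζ ∧ ‖ψ ζ - ω₁‖ ≤ 1 := by
  have hFd : DifferentiableOn ℂ F univ :=
    hF.differentiableOn (Eventually.of_forall fun n => (hφ n).differentiableOn) isOpen_univ
  have hd := hF.deriv (Eventually.of_forall fun n => (hφ n).differentiableOn) isOpen_univ
  have hcF : ContinuousAt (deriv F) ω₁ :=
    ((hFd.deriv isOpen_univ).differentiableAt univ_mem).continuousAt
  set D := ‖deriv F ω₁‖ with hDdef
  have hD0 : 0 < D := norm_pos_iff.2 hD
  obtain ⟨t, ht, ht'⟩ := Metric.tendstoLocallyUniformlyOn_iff.1 hd (D/8) (by positivity) ω₁ (mem_univ _)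
  rw [nhdsWithin_univ] at ht
  have hc1 : ∀ᶠ ω in 𝓝 ω₁, dist (deriv F ω) (deriv F ω₁) < D/8 := Metric.tendsto_nhds.1 hcF _ (by positivity)
  obtain ⟨η₀, hη₀, hball⟩ := Metric.mem_nhds_iff.1 (inter_mem ht hc1)
  set η := min η₀ 1 with hη
  have hη0 : 0 < η := by positivity
  have hball' : ball ω₁ η ⊆ ball ω₁ η₀ := ball_subset_ball (min_le_left _ _)
  have hpt := Metric.tendsto_nhds.1 (hF.tendsto_at (mem_univ ω₁)) (D * η / 64) (by positivity)
  refine ⟨D * η / 64, by positivity, ?_⟩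
  filter_upwards [ht', hpt] with n hn hn1
  rw [hc] at hn1
  have hcl : ∀ ω ∈ ball ω₁ η, ‖deriv (φ n) ω - deriv F ω₁‖ ≤ D/4 := by
    intro ω hω
    have h1 := hball (hball' hω)
    have h2 := hn ω h1.1
    have h3 : dist (deriv F ω) (deriv F ω₁) < D/8 := h1.2
    rw [← dist_eq_norm]
    simp only [Function.comp] at h2
    have := dist_triangle_left (deriv (φ n) ω) (deriv F ω₁) (deriv F ω)
    linarith
  have hlow : ∀ ω ∈ ball ω₁ η, 3/4 * D ≤ ‖deriv (φ n) ω‖ := by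
    intro ω hω
    have := norm_sub_norm_le (deriv F ω₁) (deriv (φ n) ω)
    rw [norm_sub_rev] at this
    linarith [hcl ω hω]
  have hup : ∀ ω ∈ ball ω₁ η, ‖deriv (φ n) ω‖ ≤ 5/4 * D := by
    intro ω hω
    have := norm_sub_norm_le (deriv (φ n) ω) (deriv F ω₁)
    linarith [hcl ω hω]
  have hself : ω₁ ∈ ball ω₁ η := mem_ball_self hη0
  have hl1 := hlow ω₁ hself
  have hcov := local_cover hη0 (hφ n).differentiableOn (by
    intro h; rw [h, norm_zero] at hl1; linarith) (fun z hz => by linarith [hup z hz])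
  have hsub : ball c (D * η / 64) ⊆ ball (φ n ω₁) (‖deriv (φ n) ω₁‖ * η / 24) := by
    apply ball_subset_ball'
    rw [dist_comm]
    nlinarith
  have hsub6 : closedBall ω₁ (η/6) ⊆ ball ω₁ η := closedBall_subset_ball (by linarith)
  have hex : ∀ ζ, ∃ ω, ζ ∈ ball c (D * η / 64) → ω ∈ ball ω₁ η ∧ φ n ω = ζ := by
    intro ζ
    by_cases h : ζ ∈ ball c (D * η / 64)
    · obtain ⟨ω, h1, h2⟩ := hcov (hsub h)
      exact ⟨ω, fun _ => ⟨hsub6 h1, h2⟩⟩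
    · exact ⟨0, fun h' => absurd h' h⟩
  choose ψ hψ using hex
  have hexp : ∀ x ∈ ball ω₁ η, ∀ y ∈ ball ω₁ η, D/2 * ‖y - x‖ ≤ ‖φ n y - φ n x‖ := by
    intro x hx y hy
    have := Convex.norm_image_sub_le_of_norm_hasDerivWithin_le
      (f := fun w => φ n w - deriv F ω₁ * w)
      (f' := fun w => deriv (φ n) w - deriv F ω₁ * 1) (s := ball ω₁ η) (C := D/4) (x := x) (y := y)
      (fun w hw => ((hφ n w).hasDerivAt.sub ((hasDerivAt_id w).const_mul _)).hasDerivWithinAt)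
      (fun w hw => by rw [mul_one]; exact hcl w hw) (convex_ball _ _) hx hy
    have h2 : ‖deriv F ω₁ * (y - x)‖ ≤ ‖φ n y - φ n x‖ + ‖φ n y - deriv F ω₁ * y - (φ n x - deriv F ω₁ * x)‖ := by
      rw [show deriv F ω₁ * (y - x) = (φ n y - φ n x) - (φ n y - deriv F ω₁ * y - (φ n x - deriv F ω₁ * x)) by ring]
      exact norm_sub_le _ _
    rw [norm_mul, ← hDdef] at h2
    nlinarith [norm_nonneg (y - x)]
  refine ⟨ψ, ?_, ?_⟩
  · intro ζ hζ
    have hnb : ball c (D * η / 64) ∈ 𝓝 ζ := isOpen_ball.mem_nhds hζ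
    have hcont : ContinuousAt ψ ζ := by
      refine continuousAt_of_locally_lipschitz (r := D * η / 64 - dist ζ c)
        (by rw [mem_ball] at hζ; linarith) (2 / D) ?_
      intro y hy
      have hy' : y ∈ ball c (D * η / 64) := by
        rw [mem_ball]
        have := dist_triangle y ζ c
        linarith
      have e := hexp (ψ ζ) (hψ ζ hζ).1 (ψ y) (hψ y hy').1
      rw [(hψ ζ hζ).2, (hψ y hy').2] at e
      rw [dist_eq_norm, dist_eq_norm, div_mul_eq_mul_div, le_div_iff₀ hD0]
      linarith
    refine (HasDerivAt.of_local_left_inverse hcont (hφ n (ψ ζ)).hasDerivAt ?_ ?_).differentiableAt.differentiableWithinAt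
    · intro h
      have := hlow (ψ ζ) (hψ ζ hζ).1
      rw [h, norm_zero] at this; linarith
    · filter_upwards [hnb] with y hy using (hψ y hy).2
  · intro ζ hζ
    refine ⟨(hψ ζ hζ).2, ?_⟩
    have := (hψ ζ hζ).1
    rw [mem_ball, dist_eq_norm] at this
    exact this.le.trans (min_le_right _ _)

/-- values without simple preimage -/
def Bad (F : ℂ → ℂ) : Set ℂ := {c | ∀ ω, F ω = c → deriv F ω = 0}

lemma bad_countable {F : ℂ → ℂ} (hF : Differentiable ℂ F) (h0 : deriv F 0 ≠ 0) : (Bad F).Countable := by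
  have hd : Differentiable ℂ (deriv F) := by
    have := hF.differentiableOn (s := univ)
    exact differentiableOn_univ.1 (this.deriv isOpen_univ)
  have h1 : {z | deriv F z = 0}.Countable := by
    have := AnalyticOnNhd.preimage_zero_mem_codiscrete (f := deriv F) (x := 0)
      (fun z _ => hd.analyticAt z) h0
    have h3 := (mem_codiscrete'.1 this).2
    have h4 : (deriv F ⁻¹' {0}ᶜ)ᶜ = {z | deriv F z = 0} := by ext z; simp
    rw [h4] at h3
    exact (HereditarilyLindelofSpace.isLindelof _).countable h3.to_subtype
  have h2 : ((range F)ᶜ).Subsingleton := by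
    intro a ha b hb
    by_contra hab
    have := picard hF hab (fun z h => ha ⟨z, h⟩) (fun z h => hb ⟨z, h⟩)
    apply h0
    have : F = fun _ => F 0 := funext fun z => this z 0
    rw [this]
    simp
  refine ((h1.image F).union h2.countable).mono ?_
  intro c hc
  by_cases h : c ∈ range F
  · obtain ⟨ω, rfl⟩ := h
    exact Or.inl ⟨ω, hc ω rfl, rfl⟩
  · exact Or.inr h


lemma poly_of_growth {f : ℂ → ℂ} (hf : Differentiable ℂ f) (m : ℕ) (C : ℝ)
    (h : ∃ᶠ R : ℝ in atTop, ∀ z, ‖z‖ ≤ R → ‖f z‖ ≤ C * R ^ m) :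
    ∃ p : Polynomial ℂ, ∀ z, f z = p.eval z := by
  have hz : ∀ k, m < k → iteratedDeriv k f 0 = 0 := by
    intro k hk
    by_contra hne
    have hpos : 0 < ‖iteratedDeriv k f 0‖ := norm_pos_iff.2 hne
    have hlim : Tendsto (fun R : ℝ => (k.factorial * C) * (R ^ (k - m))⁻¹) atTop (𝓝 ((k.factorial * C) * 0)) :=
      (tendsto_inv_atTop_zero.comp (tendsto_pow_atTop (by omega))).const_mul _
    rw [mul_zero] at hlim
    have hev := (hlim.eventually (gt_mem_nhds hpos)).and (eventually_gt_atTop (0:ℝ))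
    obtain ⟨R, hR, hR1, hR0⟩ := (h.and_eventually hev).exists
    have := Complex.norm_iteratedDeriv_le_of_forall_mem_sphere_norm_le (c := 0) k hR0 hf.diffContOnCl
      (fun z hz => hR z (by simpa using (mem_sphere.1 hz).le))
    have e : k.factorial * (C * R ^ m) / R ^ k = (k.factorial * C) * (R ^ (k - m))⁻¹ := by
      have : R ^ k = R ^ m * R ^ (k - m) := by rw [← pow_add]; congr 1; omega
      rw [this]; field_simp
    rw [e] at this
    linarith
  refine ⟨∑ n ∈ Finset.range (m+1), Polynomial.monomial n ((n.factorial : ℂ)⁻¹ * iteratedDeriv n f 0), fun z => ?_⟩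
  rw [← Complex.taylorSeries_eq_of_entire' 0 z hf, tsum_eq_sum (s := Finset.range (m+1))]
  · rw [Polynomial.eval_finsetSum]
    simp
  · intro n hn
    rw [hz n (by simpa using hn)]; simp

lemma exists_small {f : ℂ → ℂ} (hf : Differentiable ℂ f)
    (ht : ¬ ∃ p : Polynomial ℂ, ∀ z, f z = p.eval z) (N : ℝ) : ∃ b : ℂ, N ≤ ‖b‖ ∧ ‖f b‖ ≤ 1 := by
  by_contra! hcon
  apply ht
  set N' := max N 1 with hN'
  have hN0 : 0 < N' := by positivity
  set H : ℂ → ℂ := fun z => (f z⁻¹)⁻¹ with hH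
  have hbig : ∀ z ∈ ball (0:ℂ) N'⁻¹ \ {0}, 1 < ‖f z⁻¹‖ := by
    rintro z ⟨hz, hz0⟩
    apply hcon
    have hz0' : z ≠ 0 := hz0
    rw [mem_ball_zero_iff] at hz
    rw [norm_inv]
    have : N' < ‖z‖⁻¹ := by
      rw [lt_inv_comm₀ hN0 (norm_pos_iff.2 hz0')]; exact hz
    exact (le_max_left _ _).trans this.le
  have hnz : ∀ z ∈ ball (0:ℂ) N'⁻¹ \ {0}, f z⁻¹ ≠ 0 := fun z hz h => by
    have := hbig z hz
    rw [h, norm_zero] at this; linarith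
  have hnb : ball (0:ℂ) N'⁻¹ ∈ 𝓝 (0:ℂ) := ball_mem_nhds _ (by positivity)
  have hrem := differentiableOn_update_limUnder_of_bddAbove (f := H) hnb (by
      intro z hz
      have hz0 : z ≠ 0 := hz.2
      apply DifferentiableAt.differentiableWithinAt
      exact ((hf z⁻¹).comp z (differentiableAt_inv hz0)).inv (hnz z hz)) ⟨1, by
      rintro _ ⟨z, hz, rfl⟩
      simp only [Function.comp, hH, norm_inv]
      exact inv_le_one_of_one_le₀ (hbig z hz).le⟩
  set G := Function.update H 0 (limUnder (𝓝[≠] 0) H) with hG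
  have hGa : AnalyticAt ℂ G 0 := hrem.analyticAt hnb
  have hGne : ∀ z, z ≠ 0 → G z = H z := fun z hz => Function.update_of_ne hz _ _
  have hnot : ¬ ∀ᶠ z in 𝓝 (0:ℂ), G z = 0 := by
    intro hev
    have h1 : ∀ᶠ z in 𝓝[≠] (0:ℂ), G z = 0 := hev.filter_mono nhdsWithin_le_nhds
    have h2 : ∀ᶠ z in 𝓝[≠] (0:ℂ), z ∈ ball (0:ℂ) N'⁻¹ := mem_nhdsWithin_of_mem_nhds hnb
    obtain ⟨z, hz1, hz2, hz3⟩ := (h1.and (h2.and self_mem_nhdsWithin)).exists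
    rw [hGne z hz3] at hz1
    exact hnz z ⟨hz2, hz3⟩ (inv_eq_zero.1 hz1)
  obtain ⟨m, u, hu, hu0, hueq⟩ := hGa.exists_eventuallyEq_pow_smul_nonzero_iff.2 hnot
  have hu1 : ∀ᶠ z in 𝓝 (0:ℂ), ‖u 0‖ / 2 < ‖u z‖ :=
    hu.continuousAt.norm.eventually (lt_mem_nhds (half_lt_self (norm_pos_iff.2 hu0)))
  obtain ⟨ε, hε, hεb⟩ := Metric.eventually_nhds_iff_ball.1 (hueq.and hu1)
  have hu0' : 0 < ‖u 0‖ := norm_pos_iff.2 hu0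
  set c := ‖u 0‖ / 2 with hc
  have hc0 : 0 < c := by positivity
  have hfar : ∀ w : ℂ, ε⁻¹ < ‖w‖ → ‖f w‖ ≤ c⁻¹ * ‖w‖ ^ m := by
    intro w hw
    have hw0 : w ≠ 0 := by
      intro h; rw [h, norm_zero] at hw
      exact absurd hw (not_lt.2 (by positivity))
    have hwp : 0 < ‖w‖ := norm_pos_iff.2 hw0
    have hwb : w⁻¹ ∈ ball (0:ℂ) ε := by
      rw [mem_ball_zero_iff, norm_inv, inv_lt_comm₀ hwp hε]; exact hw
    obtain ⟨e1, e2⟩ := hεb _ hwb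
    rw [hGne _ (inv_ne_zero hw0)] at e1
    simp only [hH, inv_inv, sub_zero, smul_eq_mul] at e1
    have e3 : f w = w ^ m * (u w⁻¹)⁻¹ := by
      rw [← inv_inv (f w), e1, mul_inv, inv_pow, inv_inv]
    rw [e3, norm_mul, norm_pow, norm_inv, mul_comm]
    gcongr
  obtain ⟨M, hM⟩ := (isCompact_closedBall (0:ℂ) ε⁻¹).exists_bound_of_continuousOn hf.continuous.continuousOn
  refine poly_of_growth hf m (c⁻¹ + |M|) (Eventually.frequently ?_)
  filter_upwards [eventually_ge_atTop 1] with R hR z hz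
  have hRm : 1 ≤ R ^ m := one_le_pow₀ hR
  by_cases hzε : ε⁻¹ < ‖z‖
  · calc _ ≤ c⁻¹ * ‖z‖ ^ m := hfar z hzε
      _ ≤ c⁻¹ * R ^ m := by gcongr
      _ ≤ _ := by gcongr; linarith [abs_nonneg M]
  · have h1 := hM z (by simpa using hzε)
    have : 0 < c⁻¹ := by positivity
    nlinarith [abs_nonneg M, le_abs_self M]


lemma transc_growth {f : ℂ → ℂ} (hf : Differentiable ℂ f)
    (ht : ¬ ∃ p : Polynomial ℂ, ∀ z, f z = p.eval z) (m : ℕ) :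
    ∀ᶠ R : ℝ in atTop, ∃ z, ‖z‖ ≤ R ∧ R ^ m < ‖f z‖ := by
  have := mt (poly_of_growth hf m 1) ht
  rw [not_frequently] at this
  filter_upwards [this] with R hR
  push Not at hR
  simpa using hR

lemma max_ball {φ : ℂ → ℂ} (hφ : Differentiable ℂ φ) {T M : ℝ} (hT : 0 < T)
    (h : ∀ z ∈ sphere (0:ℂ) T, ‖φ z‖ ≤ M) {z : ℂ} (hz : ‖z‖ ≤ T) : ‖φ z‖ ≤ M := by
  refine Complex.norm_le_of_forall_mem_frontier_norm_le (U := ball 0 T) isBounded_ball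
    hφ.diffContOnCl ?_ ?_
  · rw [frontier_ball _ hT.ne']; exact h
  · rw [closure_ball _ hT.ne']; simpa using hz

lemma setup {f g : ℂ → ℂ} (hf : Differentiable ℂ f) (hg : Differentiable ℂ g)
    (hft : ¬ ∃ p : Polynomial ℂ, ∀ z, f z = p.eval z)
    (hgt : ¬ ∃ p : Polynomial ℂ, ∀ z, g z = p.eval z) :
    ∃ (s R : ℕ → ℝ) (β ζ : ℕ → ℂ), (∀ n, 0 < s n) ∧ (∀ n, 0 < R n) ∧ Tendsto R atTop atTop ∧
      (∀ m : ℕ, ∀ᶠ n in atTop, R n ^ m ≤ s n) ∧ (∀ n, ‖β n‖ = 1) ∧ (∀ n, ‖f (s n * β n)‖ ≤ 1) ∧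
      (∀ n, ‖ζ n‖ = 1) ∧ (∀ n, ‖g (R n * ζ n)‖ = s n) ∧
      (∀ n w, ‖w‖ ≤ 1 → ‖g (R n * w)‖ ≤ s n) ∧
      (∀ M : ℝ, ∀ᶠ n in atTop, ∃ w, ‖w‖ ≤ 1 ∧ M * R n < ‖f (s n * w)‖) := by
  choose b hb hfb using fun n : ℕ => exists_small hf hft (n + 1 + ‖g 0‖)
  have hunb : ∀ S : ℝ, ∃ z, S ≤ ‖g z‖ := by
    intro S
    have h1 := transc_growth hg hgt 1
    obtain ⟨R, ⟨z, -, hz⟩, hR⟩ := (h1.and (eventually_ge_atTop S)).exists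
    exact ⟨z, by rw [pow_one] at hz; linarith⟩
  have hex : ∀ n, ∃ z, ‖b n‖ ≤ ‖g z‖ ∧ ∀ w, ‖w‖ < ‖z‖ → ‖g w‖ < ‖b n‖ := by
    intro n
    have hcl : IsClosed {z | ‖b n‖ ≤ ‖g z‖} := isClosed_le continuous_const hg.continuous.norm
    obtain ⟨z, hz, hzd⟩ := hcl.exists_infDist_eq_dist (hunb ‖b n‖) 0
    refine ⟨z, hz, fun w hw => ?_⟩
    by_contra! hle
    have := Metric.infDist_le_dist_of_mem (x := (0:ℂ)) (s := {z | ‖b n‖ ≤ ‖g z‖}) (y := w) hle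
    rw [hzd, dist_zero_left, dist_zero_left] at this
    linarith
  choose z hz hzmin using hex
  have hs0 : ∀ n, 0 < ‖b n‖ := fun n => lt_of_lt_of_le (by positivity) (hb n)
  have hR0 : ∀ n, 0 < ‖z n‖ := by
    intro n
    rw [norm_pos_iff]
    intro h
    have h1 := hz n
    rw [h] at h1
    have h2 := hb n
    have : (0:ℝ) ≤ n := by positivity
    linarith
  have hle : ∀ n w, ‖w‖ ≤ ‖z n‖ → ‖g w‖ ≤ ‖b n‖ := by
    intro n w hw
    have : closedBall (0:ℂ) ‖z n‖ ⊆ {w | ‖g w‖ ≤ ‖b n‖} := by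
      rw [← closure_ball _ (hR0 n).ne']
      refine closure_minimal ?_ (isClosed_le hg.continuous.norm continuous_const)
      intro w hw
      exact (hzmin n w (by simpa using hw)).le
    exact this (by simpa using hw)
  have hsn : Tendsto (fun n => ‖b n‖) atTop atTop := by
    refine tendsto_atTop_mono (fun n => ?_) tendsto_natCast_atTop_atTop
    have := hb n
    have := norm_nonneg (g 0)
    linarith
  have hRn : Tendsto (fun n => ‖z n‖) atTop atTop := by
    rw [Filter.tendsto_atTop]
    intro T
    obtain ⟨M, hM⟩ := (isCompact_closedBall (0:ℂ) T).exists_bound_of_continuousOn hg.continuous.continuousOn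
    filter_upwards [hsn.eventually_gt_atTop M] with n hn
    by_contra! hlt
    have := hM (z n) (by simpa using hlt.le)
    linarith [hz n]
  have hpow : ∀ m : ℕ, ∀ᶠ n in atTop, ‖z n‖ ^ m ≤ ‖b n‖ := by
    intro m
    filter_upwards [hRn.eventually (transc_growth hg hgt m)] with n hn
    obtain ⟨w, hw, hw2⟩ := hn
    exact hw2.le.trans (hle n w hw)
  refine ⟨fun n => ‖b n‖, fun n => ‖z n‖, fun n => b n / ‖b n‖, fun n => z n / ‖z n‖, hs0, hR0, hRn,
    hpow, ?_, ?_, ?_, ?_, ?_, ?_⟩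
  · intro n
    rw [norm_div, norm_real, norm_norm, div_self (hs0 n).ne']
  · intro n
    rw [mul_div_cancel₀ _ (by exact_mod_cast (hs0 n).ne')]; exact hfb n
  · intro n
    rw [norm_div, norm_real, norm_norm, div_self (hR0 n).ne']
  · intro n
    rw [mul_div_cancel₀ _ (by exact_mod_cast (hR0 n).ne')]
    exact le_antisymm (hle n _ le_rfl) (hz n)
  · intro n w hw
    apply hle
    rw [norm_mul, norm_real, norm_norm]
    exact mul_le_of_le_one_right (norm_nonneg _) hw
  · intro M
    filter_upwards [hsn.eventually (transc_growth hf hft 2), hpow 1, hsn.eventually_gt_atTop |M|] with n hn h1 h2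
    obtain ⟨w, hw, hw2⟩ := hn
    refine ⟨w / ‖b n‖, ?_, ?_⟩
    · rw [norm_div, norm_real, norm_norm]
      exact div_le_one_of_le₀ hw (norm_nonneg _)
    · rw [mul_div_cancel₀ _ (by exact_mod_cast (hs0 n).ne')]
      refine lt_of_le_of_lt ?_ hw2
      rw [pow_one] at h1
      rw [sq]
      calc M * ‖z n‖ ≤ |M| * ‖z n‖ := by gcongr; exact le_abs_self M
        _ ≤ _ := by gcongr

lemma ultra_lim {𝒰 : Ultrafilter ℕ} {β : ℕ → ℂ} (hβ : ∀ n, ‖β n‖ = 1) :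
    ∃ b : ℂ, ‖b‖ = 1 ∧ Tendsto β 𝒰 (𝓝 b) := by
  obtain ⟨b, hb, hlim⟩ := (isCompact_sphere (0:ℂ) 1).ultrafilter_le_nhds (𝒰.map β) (by
    rw [Filter.le_principal_iff]
    show ∀ᶠ n in (𝒰 : Filter ℕ), β n ∈ sphere (0:ℂ) 1
    exact Eventually.of_forall fun n => by simpa using hβ n)
  exact ⟨b, by simpa using hb, hlim⟩

lemma two_spots {𝒰 : Ultrafilter ℕ} {φ : ℕ → ℂ → ℂ}
    (hφ : ∀ n, Differentiable ℂ (φ n)) {β : ℕ → ℂ} (hβ : ∀ n, ‖β n‖ = 1)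
    (h0 : ∃ M, ∀ᶠ n in (𝒰 : Filter ℕ), ‖φ n 0‖ ≤ M)
    (h1 : ∃ M, ∀ᶠ n in (𝒰 : Filter ℕ), ‖φ n (β n)‖ ≤ M)
    (hunb : ∀ M : ℝ, ∀ᶠ n in (𝒰 : Filter ℕ), ∃ w, ‖w‖ ≤ 1 ∧ M < ‖φ n w‖) :
    ∃ p q, p ≠ q ∧ Spot 𝒰 φ p ∧ Spot 𝒰 φ q := by
  by_contra! hcon
  have hp : ∃ p, ∀ q, q ≠ p → ¬ Spot 𝒰 φ q := by
    by_cases h : ∃ p, Spot 𝒰 φ p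
    · obtain ⟨p, hp⟩ := h
      exact ⟨p, fun q hq => hcon p q hq.symm hp⟩
    · push Not at h
      exact ⟨0, fun q _ => h q⟩
  obtain ⟨p, hp⟩ := hp
  have hN : ∀ q ∈ ({p}ᶜ : Set ℂ), NProp 𝒰 φ q := fun q hq => nprop_of_not_spot hφ (hp q hq)
  have hone : ∃ q ∈ ({p}ᶜ : Set ℂ), LBdd 𝒰 φ q := by
    by_cases hp0 : p = 0
    · obtain ⟨b, hb, hlim⟩ := ultra_lim (𝒰 := 𝒰) hβ
      have hbp : b ∈ ({p}ᶜ : Set ℂ) := by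
        intro h
        have : b = 0 := by rw [← hp0]; exact h
        rw [this, norm_zero] at hb; exact zero_ne_one hb
      refine ⟨b, hbp, ?_⟩
      obtain ⟨r, hr, C, hC⟩ := hN b hbp
      obtain ⟨M, hM⟩ := h1
      refine NProp.lbdd ⟨r, hr, C, hC⟩ (M := Real.exp (|C| * (1 + Real.log (1 + M)))) ?_
      filter_upwards [hC, hM, hlim (ball_mem_nhds b hr)] with n hn1 hn2 hn3
      apply norm_le_of_Lam_le
      refine (hn1 (β n) hn3 b (mem_ball_self hr)).trans ?_
      have e3 := one_le_Lam (φ n (β n))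
      exact mul_le_mul (le_abs_self C) (Lam_le_of_norm_le hn2) (by linarith) (abs_nonneg C)
    · obtain ⟨M, hM⟩ := h0
      exact ⟨0, fun h => hp0 h.symm, (hN 0 (fun h => hp0 h.symm)).lbdd hM⟩
  have hconn : IsPreconnected ({p}ᶜ : Set ℂ) :=
    (isConnected_compl_singleton_of_one_lt_rank (by simp) p).isPreconnected
  have hall := lbdd_of_preconnected hconn hN hone
  obtain ⟨M, hM⟩ := bdd_of_compact (isCompact_sphere (0:ℂ) (‖p‖ + 1)) (fun q hq => hall q (by
    intro h
    have : q = p := h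
    rw [this] at hq
    simp at hq))
  obtain ⟨n, hn, w, hw, hw2⟩ := (hM.and (hunb M)).exists
  have := max_ball (hφ n) (T := ‖p‖ + 1) (by positivity) hn (z := w) (by
    linarith [norm_nonneg p])
  linarith


lemma branch_at_spot {𝒰 : Ultrafilter ℕ} {φ : ℕ → ℂ → ℂ} (hφ : ∀ n, Differentiable ℂ (φ n)) {p : ℂ}
    (hs : Spot 𝒰 φ p) {r : ℝ} (hr : 0 < r) :
    ∃ B : Set ℂ, B.Countable ∧ ∀ c ∉ B, ∃ δ > 0, ∀ᶠ n in (𝒰 : Filter ℕ), ∃ ψ : ℂ → ℂ,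
      DifferentiableOn ℂ ψ (ball c δ) ∧ ∀ ζ ∈ ball c δ, φ n (ψ ζ) = ζ ∧ ψ ζ ∈ ball p (2*r) := by
  obtain ⟨w, ρ, F, hF, hF0, hlim, hT⟩ := zoom hφ hs hr
  refine ⟨Bad F, bad_countable hF hF0, fun c hc => ?_⟩
  simp only [Bad, mem_ofPred_eq] at hc
  push Not at hc
  obtain ⟨ω, hω, hω'⟩ := hc
  obtain ⟨δ, hδ, hev⟩ := branches (fun n => by have := hφ n; fun_prop) hlim hω hω'
  refine ⟨δ, hδ, ?_⟩
  filter_upwards [hev, hT (‖ω‖ + 1)] with n hn hn2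
  obtain ⟨ψ, hψ, hψ'⟩ := hn
  refine ⟨fun ζ => w n + ρ n * ψ ζ, by fun_prop, fun ζ hζ => ⟨(hψ' ζ hζ).1, hn2 _ ?_⟩⟩
  have := norm_add_le (ψ ζ - ω) ω
  rw [sub_add_cancel] at this
  linarith [(hψ' ζ hζ).2]

/-- local auxiliary functions omitting two values off the real line -/
def Om (l : Filter ℕ) (γ : ℕ → ℂ → ℂ) (c : ℂ) : Prop :=
  ∃ δ > 0, ∃ L > 0, ∀ᶠ n in l, ∃ k : ℂ → ℂ, DifferentiableOn ℂ k (ball c δ) ∧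
    (∀ ζ ∈ ball c δ, ζ.im ≠ 0 → k ζ ≠ 0 ∧ k ζ ≠ 1) ∧
    ∀ ζ ∈ ball c δ, ‖k ζ‖ ≤ L * (1 + ‖γ n ζ‖) ∧ ‖γ n ζ‖ ≤ L * (1 + ‖k ζ‖)

lemma om_exists {𝒰 : Ultrafilter ℕ} {φ γ : ℕ → ℂ → ℂ} (hφ : ∀ n, Differentiable ℂ (φ n))
    (hγ : ∀ n, Differentiable ℂ (γ n)) {p q : ℂ} (hpq : p ≠ q)
    (hp : Spot 𝒰 φ p) (hq : Spot 𝒰 φ q)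
    (hfix : ∀ ε > 0, ∀ᶠ n in (𝒰 : Filter ℕ), ∀ ζ : ℂ, ε ≤ ‖ζ‖ → ζ.im ≠ 0 → φ n (γ n ζ) ≠ ζ) :
    ∃ B : Set ℂ, B.Countable ∧ ∀ c ∉ B, Om 𝒰 γ c := by
  set r := ‖p - q‖ / 8 with hr
  have hpq0 : 0 < ‖p - q‖ := norm_pos_iff.2 (sub_ne_zero.2 hpq)
  have hr0 : 0 < r := by positivity
  obtain ⟨B₀, hB₀, h₀⟩ := branch_at_spot hφ hp hr0
  obtain ⟨B₁, hB₁, h₁⟩ := branch_at_spot hφ hq hr0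
  refine ⟨insert 0 (B₀ ∪ B₁), (hB₀.union hB₁).insert 0, fun c hc => ?_⟩
  simp only [mem_insert_iff, mem_union, not_or] at hc
  obtain ⟨hc0, hcB₀, hcB₁⟩ := hc
  obtain ⟨δ₀, hδ₀, e₀⟩ := h₀ c hcB₀
  obtain ⟨δ₁, hδ₁, e₁⟩ := h₁ c hcB₁
  have hcn : 0 < ‖c‖ := norm_pos_iff.2 hc0
  set δ := min (min δ₀ δ₁) (‖c‖/2) with hδ
  have hδp : 0 < δ := by positivity
  have hs₀ : ball c δ ⊆ ball c δ₀ := ball_subset_ball ((min_le_left _ _).trans (min_le_left _ _))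
  have hs₁ : ball c δ ⊆ ball c δ₁ := ball_subset_ball ((min_le_left _ _).trans (min_le_right _ _))
  set P := ‖p‖ + ‖q‖ + 4 * r with hP
  have hP0 : 0 < P := by positivity
  refine ⟨δ, hδp, (1 + P) / (4 * r) + 2 * P, by positivity, ?_⟩
  filter_upwards [e₀, e₁, hfix (‖c‖/2) (by positivity)] with n hn₀ hn₁ hnf
  obtain ⟨ψ₀, hψ₀, hψ₀'⟩ := hn₀
  obtain ⟨ψ₁, hψ₁, hψ₁'⟩ := hn₁
  have hsep : ∀ ζ ∈ ball c δ, 4 * r ≤ ‖ψ₁ ζ - ψ₀ ζ‖ := by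
    intro ζ hζ
    have a0 := (hψ₀' ζ (hs₀ hζ)).2
    have a1 := (hψ₁' ζ (hs₁ hζ)).2
    rw [mem_ball] at a0 a1
    have := dist_triangle4 p (ψ₀ ζ) (ψ₁ ζ) q
    rw [dist_comm p (ψ₀ ζ), dist_eq_norm p q, dist_comm (ψ₀ ζ) (ψ₁ ζ), dist_eq_norm (ψ₁ ζ) (ψ₀ ζ)] at this
    linarith
  have hne : ∀ ζ ∈ ball c δ, ψ₁ ζ - ψ₀ ζ ≠ 0 := by
    intro ζ hζ h
    have := hsep ζ hζ
    rw [h, norm_zero] at this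
    linarith
  have hb₀ : ∀ ζ ∈ ball c δ, ‖ψ₀ ζ‖ ≤ P := by
    intro ζ hζ
    have a0 := (hψ₀' ζ (hs₀ hζ)).2
    rw [mem_ball, dist_eq_norm] at a0
    have := norm_add_le (ψ₀ ζ - p) p
    rw [sub_add_cancel] at this
    have := norm_nonneg q
    linarith
  have hb₁ : ∀ ζ ∈ ball c δ, ‖ψ₁ ζ‖ ≤ P := by
    intro ζ hζ
    have a0 := (hψ₁' ζ (hs₁ hζ)).2
    rw [mem_ball, dist_eq_norm] at a0
    have := norm_add_le (ψ₁ ζ - q) q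
    rw [sub_add_cancel] at this
    have := norm_nonneg p
    linarith
  have hfar : ∀ ζ ∈ ball c δ, ‖c‖/2 ≤ ‖ζ‖ := by
    intro ζ hζ
    rw [mem_ball, dist_comm, dist_eq_norm] at hζ
    have := norm_sub_norm_le c ζ
    have : δ ≤ ‖c‖/2 := min_le_right _ _
    linarith
  have hγn := (hγ n).differentiableOn (s := ball c δ)
  refine ⟨fun ζ => (γ n ζ - ψ₀ ζ) / (ψ₁ ζ - ψ₀ ζ), ?_, ?_, ?_⟩
  · exact (hγn.sub (hψ₀.mono hs₀)).div ((hψ₁.mono hs₁).sub (hψ₀.mono hs₀)) hne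
  · intro ζ hζ him
    constructor
    · intro h
      rw [div_eq_zero_iff] at h
      rcases h with h | h
      · refine hnf ζ (hfar ζ hζ) him ?_
        rw [sub_eq_zero.1 h]
        exact (hψ₀' ζ (hs₀ hζ)).1
      · exact hne ζ hζ h
    · intro h
      rw [div_eq_one_iff_eq (hne ζ hζ)] at h
      refine hnf ζ (hfar ζ hζ) him ?_
      rw [sub_left_inj.1 h]
      exact (hψ₁' ζ (hs₁ hζ)).1
  · intro ζ hζ
    have c0 := hb₀ ζ hζ
    have c1 := hb₁ ζ hζ
    have c2 := hsep ζ hζ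
    have cγ := norm_nonneg (γ n ζ)
    constructor
    · rw [norm_div]
      calc _ ≤ (‖γ n ζ‖ + P) / (4 * r) := by
            gcongr
            exact (norm_sub_le _ _).trans (by gcongr)
        _ ≤ (1 + P) / (4 * r) * (1 + ‖γ n ζ‖) := by
            rw [div_mul_eq_mul_div]
            gcongr
            nlinarith
        _ ≤ _ := by gcongr; linarith
    · set K := (γ n ζ - ψ₀ ζ) / (ψ₁ ζ - ψ₀ ζ) with hK
      have : γ n ζ = ψ₀ ζ + K * (ψ₁ ζ - ψ₀ ζ) := by
        rw [hK, div_mul_cancel₀ _ (hne ζ hζ)]; ring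
      have hKn := norm_nonneg K
      calc ‖γ n ζ‖ ≤ ‖ψ₀ ζ‖ + ‖K‖ * (‖ψ₁ ζ‖ + ‖ψ₀ ζ‖) := by
            rw [this]
            refine (norm_add_le _ _).trans ?_
            rw [norm_mul]
            gcongr
            exact norm_sub_le _ _
        _ ≤ P + ‖K‖ * (P + P) := by gcongr
        _ ≤ (2 * P) * (1 + ‖K‖) := by nlinarith
        _ ≤ _ := by
            gcongr
            have : 0 < (1 + P) / (4 * r) := by positivity
            linarith

lemma Lam_comp {a b : ℂ} {L : ℝ} (hL : 0 < L) (h : ‖a‖ ≤ L * (1 + ‖b‖)) :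
    Lam a ≤ (1 + Real.log (1 + L)) * Lam b := by
  have h1 : 1 + ‖a‖ ≤ (1 + L) * (1 + ‖b‖) := by nlinarith [norm_nonneg b]
  have h2 := Real.log_le_log (by positivity) h1
  rw [Real.log_mul (by positivity) (by positivity)] at h2
  have h3 : 0 ≤ Real.log (1 + L) := Real.log_nonneg (by linarith)
  have h4 := one_le_Lam b
  unfold Lam at *
  nlinarith

lemma nprop_of_om {l : Filter ℕ} {γ : ℕ → ℂ → ℂ} {c : ℂ} (h : Om l γ c) (hc : c.im ≠ 0) : NProp l γ c := by
  obtain ⟨δ, hδ, L, hL, hev⟩ := h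
  obtain ⟨P, hP⟩ := schottky'
  have hcp : 0 < |c.im| := abs_pos.2 hc
  set ρ := min δ |c.im| with hρ
  have hρ0 : 0 < ρ := by positivity
  have hsub : ball c ρ ⊆ ball c δ := ball_subset_ball (min_le_left _ _)
  have him : ∀ z ∈ ball c ρ, z.im ≠ 0 := by
    intro z hz h
    rw [mem_ball, dist_comm, dist_eq_norm] at hz
    have h1 := abs_im_le_norm (c - z)
    rw [sub_im, h, sub_zero] at h1
    have : ρ ≤ |c.im| := min_le_right _ _
    linarith
  set A := 1 + Real.log (1 + L) with hA
  have hA0 : 0 ≤ A := by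
    have : 0 ≤ Real.log (1 + L) := Real.log_nonneg (by linarith)
    linarith
  refine ⟨ρ / 8, by positivity, A * (2 ^ P * A), ?_⟩
  filter_upwards [hev] with n hn x hx y hy
  obtain ⟨k, hk, hom, hcomp⟩ := hn
  have hs8 : ball c (ρ/8) ⊆ ball c ρ := ball_subset_ball (by linarith)
  have k1 := Lam_comp hL (hcomp y (hsub (hs8 hy))).2
  have k2 := Lam_comp hL (hcomp x (hsub (hs8 hx))).1
  rw [mem_ball] at hx hy
  have hsx : ball x (ρ/2) ⊆ ball c ρ := by
    apply ball_subset_ball'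
    linarith
  have := hP k x (ρ/2) (by positivity) (hk.mono (hsx.trans hsub))
    (fun z hz => hom z (hsub (hsx hz)) (him z (hsx hz))) y (by
      rw [mem_closedBall]
      have := dist_triangle_right y x c
      linarith)
  calc _ ≤ A * Lam (k y) := k1
    _ ≤ A * (2 ^ P * Lam (k x)) := by gcongr
    _ ≤ A * (2 ^ P * (A * Lam (γ n x))) := by gcongr
    _ = _ := by ring

lemma lbdd_nonreal {l : Filter ℕ} {γ : ℕ → ℂ → ℂ} {B : Set ℂ} (hB : B.Countable)
    (hom : ∀ c ∉ B, Om l γ c) (h0 : ∀ c, ‖c‖ < 1 → LBdd l γ c) {c : ℂ} (hcB : c ∉ B) (hc : c.im ≠ 0) :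
    LBdd l γ c := by
  obtain ⟨r, hr, C, hC⟩ := nprop_of_om (hom c hcB) hc
  have hc0 : c ≠ 0 := by rintro rfl; simp at hc
  set T : Set ℝ := (fun b : ℂ => (b / c).im / (b / c).re) '' B with hT
  have hTc : T.Countable := hB.image _
  have hcont : Continuous fun t : ℝ => c * (1 + (t:ℂ) * I) := by fun_prop
  have e1 : ∀ᶠ t : ℝ in 𝓝 0, c * (1 + (t:ℂ) * I) ∈ ball c r := by
    apply hcont.continuousAt.eventually_mem
    simpa using ball_mem_nhds c hr
  have e2 : ∀ᶠ t : ℝ in 𝓝 0, (c * (1 + (t:ℂ) * I)).im ≠ 0 := by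
    have : Continuous fun t : ℝ => (c * (1 + (t:ℂ) * I)).im := continuous_im.comp hcont
    apply this.continuousAt.eventually_ne
    simpa using hc
  obtain ⟨t, htT, ht1, ht2⟩ : ∃ t, t ∈ Tᶜ ∧ c * (1 + (t:ℂ) * I) ∈ ball c r ∧ (c * (1 + (t:ℂ) * I)).im ≠ 0 := by
    obtain ⟨t, ht, h⟩ := (hTc.dense_compl ℝ).exists_mem_open isOpen_interior
      (⟨0, mem_interior_iff_mem_nhds.2 (e1.and e2)⟩ : (interior {t : ℝ | c * (1 + (t:ℂ) * I) ∈ ball c r ∧ (c * (1 + (t:ℂ) * I)).im ≠ 0}).Nonempty)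
    have h' := interior_subset h
    exact ⟨t, ht, h'.1, h'.2⟩
  set c' := c * (1 + (t:ℂ) * I) with hc'
  have hc'0 : c' ≠ 0 := by intro h; rw [h] at ht2; simp at ht2
  set S : Set ℂ := (fun s : ℝ => (s:ℂ) * c') '' Ioc 0 1 with hS
  have hSB : ∀ x ∈ S, x ∉ B := by
    rintro _ ⟨s, hs, rfl⟩ hb
    apply htT
    refine ⟨_, hb, ?_⟩
    have : (s:ℂ) * c' / c = (s:ℂ) * (1 + (t:ℂ) * I) := by rw [hc']; field_simp
    simp only [this]
    have hs0 := hs.1.ne'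
    simp
    field_simp
  have hN : ∀ x ∈ S, NProp l γ x := by
    intro x hx
    refine nprop_of_om (hom x (hSB x hx)) ?_
    obtain ⟨s, hs, rfl⟩ := hx
    simp only [im_ofReal_mul]
    exact mul_ne_zero hs.1.ne' ht2
  have hconn : IsPreconnected S := isPreconnected_Ioc.image _ (by fun_prop)
  have hc'p : 0 < ‖c'‖ := norm_pos_iff.2 hc'0
  have hall := lbdd_of_preconnected hconn hN (by
    have hs : 0 < min 1 (1 / (2 * ‖c'‖)) := by positivity
    refine ⟨((min 1 (1 / (2 * ‖c'‖)) : ℝ) : ℂ) * c', ⟨_, ⟨hs, min_le_left _ _⟩, rfl⟩, h0 _ ?_⟩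
    rw [norm_mul, norm_real, Real.norm_of_nonneg hs.le]
    calc _ ≤ 1 / (2 * ‖c'‖) * ‖c'‖ := by gcongr; exact min_le_right _ _
      _ < 1 := by field_simp; norm_num)
  obtain ⟨r', hr', M, hM⟩ := hall c' ⟨1, by simp, by simp⟩
  refine NProp.lbdd_of_point hr hC ht1 (M := M) ?_
  filter_upwards [hM] with n hn using hn _ (mem_ball_self hr')


lemma sector_re (p : ℕ) : ∃ ε : ℝ, 0 < ε ∧ ε ≤ 1 ∧ ∀ u : ℂ, 0 < u.re → |u.im| ≤ ε * u.re →
    (u.re ^ p)⁻¹ / 2 ≤ ((u ^ p)⁻¹).re := by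
  have hc : ContinuousAt (fun t : ℝ => (((1 + (t:ℂ) * I) ^ p)⁻¹).re) 0 := by
    apply continuous_re.continuousAt.comp
    apply ContinuousAt.inv₀
    · fun_prop
    · simp
  have h1 : ∀ᶠ t : ℝ in 𝓝 0, (1/2 : ℝ) < (((1 + (t:ℂ) * I) ^ p)⁻¹).re :=
    hc.eventually_const_lt (by norm_num)
  obtain ⟨e, he, h⟩ := Metric.eventually_nhds_iff.1 h1
  refine ⟨min (e/2) 1, by positivity, min_le_right _ _, ?_⟩
  intro u hu hui
  have ht : |u.im / u.re| ≤ e / 2 := by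
    rw [abs_div, abs_of_pos hu, div_le_iff₀ hu]
    exact hui.trans (by gcongr; exact min_le_left _ _)
  have := @h (u.im / u.re) (by rw [dist_zero_right, Real.norm_eq_abs]; linarith)
  have hur : (u.re : ℂ) ≠ 0 := by exact_mod_cast hu.ne'
  have hue : u = (u.re : ℂ) * (1 + ((u.im / u.re : ℝ) : ℂ) * I) := by
    push_cast
    field_simp
    exact (re_add_im u).symm
  have h2 : ((u ^ p)⁻¹).re = (u.re ^ p)⁻¹ * (((1 + ((u.im / u.re : ℝ):ℂ) * I) ^ p)⁻¹).re := by
    conv_lhs => rw [hue, mul_pow, mul_inv, ← ofReal_pow, ← ofReal_inv, re_ofReal_mul]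
  rw [h2]
  have : 0 < (u.re ^ p)⁻¹ := by positivity
  nlinarith

lemma growth_real {P : ℕ} (hP : ∀ (k : ℂ → ℂ) (a : ℂ) (r : ℝ), 0 < r → DifferentiableOn ℂ k (ball a r) →
    (∀ z ∈ ball a r, k z ≠ 0 ∧ k z ≠ 1) → ∀ z ∈ closedBall a (r/2), Lam (k z) ≤ 2^P * Lam (k a))
    {c : ℂ} (hc : c.im = 0) {h V : ℝ} (hh : 0 < h) {k : ℂ → ℂ} (hk : DifferentiableOn ℂ k (ball c (4*h)))
    (hom : ∀ z ∈ ball c (4*h), z.im ≠ 0 → k z ≠ 0 ∧ k z ≠ 1)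
    (hV : ∀ z : ℂ, |z.re - c.re| ≤ h → h/2 ≤ |z.im| → |z.im| ≤ h → Lam (k z) ≤ V) (j : ℕ) :
    ∀ z : ℂ, |z.re - c.re| ≤ h → h/2^(j+1) ≤ |z.im| → |z.im| ≤ h → |z.im| ^ P * Lam (k z) ≤ h ^ P * V := by
  induction j with
  | zero =>
    intro z h1 h2 h3
    have h4 := hV z h1 (by simpa using h2) h3
    have := one_le_Lam (k z)
    gcongr
  | succ j ih =>
    intro z h1 h2 h3
    by_cases hz : h/2 ≤ |z.im|
    · have h4 := hV z h1 hz h3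
      have := one_le_Lam (k z)
      gcongr
    push Not at hz
    have hy : 0 < |z.im| := lt_of_lt_of_le (by positivity) h2
    set a : ℂ := z + z.im * I with ha
    have are : a.re = z.re := by simp [ha]
    have aim : a.im = 2 * z.im := by simp [ha]; ring
    have haim : |a.im| = 2 * |z.im| := by rw [aim, abs_mul, abs_two]
    have hsub : ball a (2 * |z.im|) ⊆ ball c (4*h) := by
      apply ball_subset_ball'
      rw [dist_eq_norm]
      have := norm_le_abs_re_add_abs_im (a - c)
      rw [sub_re, sub_im, hc, sub_zero, haim, are] at this
      linarith
    have := hP k a (2 * |z.im|) (by positivity) (hk.mono hsub) (fun w hw => hom w (hsub hw) (by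
      intro hw0
      rw [mem_ball, dist_comm, dist_eq_norm] at hw
      have := abs_im_le_norm (a - w)
      rw [sub_im, hw0, sub_zero, haim] at this
      linarith)) z (by
        rw [mem_closedBall, dist_comm, dist_eq_norm, ha]
        simp)
    have h5 := ih a (by rw [are]; exact h1) (by
      rw [haim]
      have : h / 2 ^ (j+1) = 2 * (h / 2^(j+1+1)) := by field_simp; ring
      linarith) (by rw [haim]; linarith)
    calc |z.im| ^ P * Lam (k z) ≤ |z.im| ^ P * (2 ^ P * Lam (k a)) := by gcongr
      _ = |a.im| ^ P * Lam (k a) := by rw [haim, mul_pow]; ring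
      _ ≤ _ := h5

lemma real_bound {c : ℂ} (hc : c.im = 0) {h V : ℝ} (hh : 0 < h) : ∃ ρ > 0, ∃ M : ℝ, ∀ k : ℂ → ℂ,
    DifferentiableOn ℂ k (ball c (4*h)) →
    (∀ z ∈ ball c (4*h), z.im ≠ 0 → k z ≠ 0 ∧ k z ≠ 1) →
    (∀ z : ℂ, |z.re - c.re| ≤ h → h/2 ≤ |z.im| → |z.im| ≤ h → Lam (k z) ≤ V) →
    ∀ z ∈ ball c ρ, ‖k z‖ ≤ M := by
  obtain ⟨P₀, hP₀⟩ := schottky'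
  set P := P₀ + 1 with hPdef
  have hP : ∀ (k : ℂ → ℂ) (a : ℂ) (r : ℝ), 0 < r → DifferentiableOn ℂ k (ball a r) →
    (∀ z ∈ ball a r, k z ≠ 0 ∧ k z ≠ 1) → ∀ z ∈ closedBall a (r/2), Lam (k z) ≤ 2^P * Lam (k a) := by
    intro k a r h1 h2 h3 z hz
    refine (hP₀ k a r h1 h2 h3 z hz).trans ?_
    have := one_le_Lam (k a)
    gcongr
    · norm_num
    · omega
  obtain ⟨ε, hε, hε1, hsec⟩ := sector_re P
  set V' := max V 1 with hV'
  have hV'0 : 0 < V' := lt_of_lt_of_le one_pos (le_max_right _ _)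
  set E := h ^ P * V' with hE
  have hE0 : 0 < E := by positivity
  set E' := 2 * E / ε ^ P with hE'
  have hE'0 : 0 < E' := by positivity
  refine ⟨ε * h / 4, by positivity, Real.exp (2 * (E' * ((h/2) ^ P)⁻¹)), ?_⟩
  intro k hk hom hV z hz
  have hgr : ∀ w : ℂ, |w.re - c.re| ≤ h → 0 < |w.im| → |w.im| ≤ h → ‖k w‖ ≤ Real.exp (E / |w.im| ^ P) := by
    intro w h1 h2 h3
    apply norm_le_of_Lam_le
    rw [le_div_iff₀ (by positivity), mul_comm]
    have : ∃ j : ℕ, h / 2 ^ (j+1) ≤ |w.im| := by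
      obtain ⟨j, hj⟩ := pow_unbounded_of_one_lt (h / |w.im|) (one_lt_two)
      refine ⟨j, ?_⟩
      rw [div_lt_iff₀ h2] at hj
      rw [div_le_iff₀ (by positivity), pow_succ]
      have : 0 < 2 ^ j * |w.im| := by positivity
      linarith
    obtain ⟨j, hj⟩ := this
    exact growth_real hP hc hh hk hom (fun w a b d => (hV w a b d).trans (le_max_left _ _)) j w h1 hj h3
  -- compact bound
  have hsubc : closedBall c (2*h) ⊆ ball c (4*h) := closedBall_subset_ball (by linarith)
  obtain ⟨Mn, hMn⟩ := (isCompact_closedBall c (2*h)).exists_bound_of_continuousOn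
    (hk.continuousOn.mono hsubc)
  -- choose η
  obtain ⟨η, hη0, hηh, hη⟩ : ∃ η : ℝ, 0 < η ∧ η < h / 2 ∧ Mn * Real.exp (-(E' * (η ^ P)⁻¹ / 2)) ≤ 1 := by
    have t1 : Tendsto (fun η : ℝ => (η ^ P)⁻¹) (𝓝[>] 0) atTop := by
      apply tendsto_inv_nhdsGT_zero.comp
      apply tendsto_nhdsWithin_iff.2 ⟨?_, ?_⟩
      · have : Tendsto (fun η : ℝ => η ^ P) (𝓝 0) (𝓝 (0 ^ P)) := (continuous_pow P).tendsto 0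
        rw [zero_pow (by omega)] at this
        exact this.mono_left nhdsWithin_le_nhds
      · filter_upwards [self_mem_nhdsWithin] with x hx
        exact pow_pos (mem_Ioi.1 hx) P
    have t2 : Tendsto (fun η : ℝ => Mn * Real.exp (-(E' * (η ^ P)⁻¹ / 2))) (𝓝[>] 0) (𝓝 (Mn * 0)) := by
      apply Tendsto.const_mul
      apply Real.tendsto_exp_neg_atTop_nhds_zero.comp
      have := (t1.const_mul_atTop hE'0).atTop_div_const (show (0:ℝ) < 2 by norm_num)
      exact this
    rw [mul_zero] at t2
    have e1 := t2.eventually_le_const one_pos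
    have e2 : ∀ᶠ η : ℝ in 𝓝[>] 0, η ∈ Ioo 0 (h/2) := Ioo_mem_nhdsGT (by positivity)
    obtain ⟨η, a, b⟩ := (e1.and e2).exists
    exact ⟨η, b.1, b.2, a⟩
  set Q : Set ℂ := {w | |w.re - c.re| < h - η ∧ |w.im| < ε * (h - |w.re - c.re|)} with hQ
  have hQo : IsOpen Q := by
    have i1 : IsOpen {w : ℂ | |w.re - c.re| < h - η} := isOpen_lt (by fun_prop) (by fun_prop)
    have i2 : IsOpen {w : ℂ | |w.im| < ε * (h - |w.re - c.re|)} := isOpen_lt (by fun_prop) (by fun_prop)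
    exact i1.inter i2
  set Q' : Set ℂ := {w | |w.re - c.re| ≤ h - η ∧ |w.im| ≤ ε * (h - |w.re - c.re|)} with hQ'
  have hQ'c : IsClosed Q' := by
    have i1 : IsClosed {w : ℂ | |w.re - c.re| ≤ h - η} := isClosed_le (by fun_prop) (by fun_prop)
    have i2 : IsClosed {w : ℂ | |w.im| ≤ ε * (h - |w.re - c.re|)} := isClosed_le (by fun_prop) (by fun_prop)
    exact i1.inter i2
  have hQQ' : closure Q ⊆ Q' := by
    apply closure_minimal _ hQ'c
    intro w hw
    exact ⟨hw.1.le, hw.2.le⟩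
  have hQ'b : Q' ⊆ closedBall c (2*h) := by
    intro w hw
    rw [mem_closedBall, dist_eq_norm]
    have := norm_le_abs_re_add_abs_im (w - c)
    rw [sub_re, sub_im, hc, sub_zero] at this
    have h2 := hw.2
    have h1 := hw.1
    have : |w.im| ≤ 1 * (h - |w.re - c.re|) := h2.trans (by gcongr; linarith)
    linarith
  set m : ℂ → ℂ := fun w => Complex.exp (-(E' * (((h - (w - c)) ^ P)⁻¹ + ((h + (w - c)) ^ P)⁻¹))) with hm
  have hure : ∀ w ∈ Q', 0 < (h - (w - c)).re ∧ 0 < (h + (w - c)).re ∧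
      h - |w.re - c.re| ≤ (h - (w - c)).re ∧ h - |w.re - c.re| ≤ (h + (w - c)).re := by
    intro w hw
    have h1 := hw.1
    simp only [sub_re, add_re, ofReal_re]
    have := abs_le.1 (le_refl |w.re - c.re|)
    refine ⟨?_, ?_, ?_, ?_⟩ <;> linarith
  have hm1 : ∀ w ∈ Q', ‖m w‖ ≤ Real.exp (-(E' * ((h - |w.re - c.re|) ^ P)⁻¹ / 2)) := by
    intro w hw
    obtain ⟨u1, u2, u3, u4⟩ := hure w hw
    have hd : 0 < h - |w.re - c.re| := by have := hw.1; linarith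
    rw [hm, Complex.norm_exp]
    apply Real.exp_le_exp.2
    rw [neg_re, re_ofReal_mul, add_re, neg_le_neg_iff]
    have i1 := hsec (h - (w - c)) u1 (by
      have : (h - (w - c)).im = - w.im := by simp [hc]
      rw [this, abs_neg]
      exact hw.2.trans (by gcongr))
    have i2 := hsec (h + (w - c)) u2 (by
      have : (h + (w - c)).im = w.im := by simp [hc]
      rw [this]
      exact hw.2.trans (by gcongr))
    have j1 : 0 < ((h - (w - c)).re ^ P)⁻¹ := by positivity
    have j2 : 0 < ((h + (w - c)).re ^ P)⁻¹ := by positivity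
    have key : ((h - |w.re - c.re|) ^ P)⁻¹ / 2 ≤ (((h - (w - c)) ^ P)⁻¹).re + (((h + (w - c)) ^ P)⁻¹).re := by
      rcases abs_cases (w.re - c.re) with ⟨e, _⟩ | ⟨e, _⟩
      · have : (h - (w - c)).re = h - |w.re - c.re| := by rw [e]; simp
        rw [this] at i1
        linarith
      · have : (h + (w - c)).re = h - |w.re - c.re| := by rw [e]; simp; ring
        rw [this] at i2
        linarith
    calc _ = E' * (((h - |w.re - c.re|) ^ P)⁻¹ / 2) := by ring
      _ ≤ _ := by gcongr
  have hdm : DifferentiableOn ℂ (fun w => k w * m w) Q' := by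
    apply DifferentiableOn.mul (hk.mono (hQ'b.trans hsubc))
    intro w hw
    obtain ⟨u1, u2, -, -⟩ := hure w hw
    have n1 : ((h:ℂ) - (w - c)) ^ P ≠ 0 := by
      apply pow_ne_zero
      intro h0; rw [h0] at u1; simp at u1
    have n2 : ((h:ℂ) + (w - c)) ^ P ≠ 0 := by
      apply pow_ne_zero
      intro h0; rw [h0] at u2; simp at u2
    apply DifferentiableAt.differentiableWithinAt
    apply DifferentiableAt.cexp
    apply DifferentiableAt.neg
    apply DifferentiableAt.const_mul
    apply DifferentiableAt.add
    · exact DifferentiableAt.inv (by fun_prop) n1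
    · exact DifferentiableAt.inv (by fun_prop) n2
  have hfr : ∀ w ∈ frontier Q, ‖k w * m w‖ ≤ 1 := by
    intro w hw
    have hwQ' : w ∈ Q' := hQQ' (frontier_subset_closure hw)
    have hwQ : w ∉ Q := by
      rw [hQo.frontier_eq] at hw
      exact hw.2
    have hm2 := hm1 w hwQ'
    rw [norm_mul]
    have hd : 0 < h - |w.re - c.re| := by have := hwQ'.1; linarith
    by_cases hx : |w.re - c.re| < h - η
    · have hy : |w.im| = ε * (h - |w.re - c.re|) := by
        apply le_antisymm hwQ'.2
        by_contra hcon
        push Not at hcon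
        exact hwQ ⟨hx, hcon⟩
      have hg := hgr w (by linarith) (by rw [hy]; positivity) (by
        rw [hy]
        have := abs_nonneg (w.re - c.re)
        nlinarith)
      calc ‖k w‖ * ‖m w‖ ≤ Real.exp (E / |w.im| ^ P) * Real.exp (-(E' * ((h - |w.re - c.re|) ^ P)⁻¹ / 2)) := by
            gcongr
        _ = 1 := by
            rw [← Real.exp_add, hy, hE', mul_pow, Real.exp_eq_one_iff]
            field_simp
            ring
    · have hx' : h - |w.re - c.re| = η := by
        have := hwQ'.1
        push Not at hx
        linarith
      rw [hx'] at hm2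
      calc ‖k w‖ * ‖m w‖ ≤ Mn * Real.exp (-(E' * (η ^ P)⁻¹ / 2)) := by
            have b1 := hMn w (hQ'b hwQ')
            have := (norm_nonneg _).trans b1
            gcongr
        _ ≤ 1 := hη
  have hQb : Bornology.IsBounded Q := (isBounded_closedBall (x := c) (r := 2*h)).subset (subset_closure.trans (hQQ'.trans hQ'b))
  have hzb : |z.re - c.re| < ε * h / 4 ∧ |z.im| < ε * h / 4 := by
    rw [mem_ball, dist_eq_norm] at hz
    have a1 := abs_re_le_norm (z - c)
    have a2 := abs_im_le_norm (z - c)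
    rw [sub_re] at a1
    rw [sub_im, hc, sub_zero] at a2
    exact ⟨by linarith, by linarith⟩
  have hεh : ε * h ≤ h := by nlinarith
  have hzQ : z ∈ Q := by
    refine ⟨by linarith [hzb.1], ?_⟩
    have : ε * (h / 2) ≤ ε * (h - |z.re - c.re|) := by
      gcongr
      linarith [hzb.1]
    have h0 : 0 < ε * h := by positivity
    linarith [hzb.2]
  have hfin := Complex.norm_le_of_forall_mem_frontier_norm_le hQb
    (DifferentiableOn.diffContOnCl (hdm.mono hQQ')) hfr (subset_closure hzQ)
  rw [norm_mul] at hfin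
  have hmz : Real.exp (-(2 * (E' * ((h/2) ^ P)⁻¹))) ≤ ‖m z‖ := by
    rw [hm, Complex.norm_exp]
    apply Real.exp_le_exp.2
    rw [neg_re, re_ofReal_mul, add_re, neg_le_neg_iff]
    have hb : ∀ u : ℂ, h / 2 ≤ u.re → ((u ^ P)⁻¹).re ≤ ((h/2) ^ P)⁻¹ := by
      intro u hu
      refine (re_le_norm _).trans ?_
      rw [norm_inv, norm_pow]
      have := hu.trans (re_le_norm u)
      gcongr
    obtain ⟨-, -, u3, u4⟩ := hure z (hQQ' (subset_closure hzQ))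
    have i1 := hb _ ((by linarith [hzb.1] : h / 2 ≤ h - |z.re - c.re|).trans u3)
    have i2 := hb _ ((by linarith [hzb.1] : h / 2 ≤ h - |z.re - c.re|).trans u4)
    nlinarith
  rw [Real.exp_neg] at hmz
  have hpos := Real.exp_pos (2 * (E' * ((h/2) ^ P)⁻¹))
  rw [inv_le_iff_one_le_mul₀ hpos] at hmz
  nlinarith [norm_nonneg (k z), norm_nonneg (m z)]

lemma lbdd_real {l : Filter ℕ} {γ : ℕ → ℂ → ℂ} {B : Set ℂ} (hB : B.Countable)
    (hom : ∀ c ∉ B, Om l γ c) (h0 : ∀ c, ‖c‖ < 1 → LBdd l γ c) {c : ℂ} (hcB : c ∉ B) (hc : c.im = 0) :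
    LBdd l γ c := by
  obtain ⟨δ, hδ, L, hL, hev⟩ := hom c hcB
  have hnr : ∀ w ∈ ball c δ, w.im ≠ 0 → LBdd l γ w := by
    intro w hw hwi
    rw [mem_ball] at hw
    have hsub : ball w (δ - dist w c) ⊆ ball c δ := ball_subset_ball' (by linarith)
    have how : Om l γ w := by
      refine ⟨δ - dist w c, by linarith, L, hL, ?_⟩
      filter_upwards [hev] with n hn
      obtain ⟨k, h1, h2, h3⟩ := hn
      exact ⟨k, h1.mono hsub, fun z hz => h2 z (hsub hz), fun z hz => h3 z (hsub hz)⟩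
    obtain ⟨r, hr, C, hC⟩ := nprop_of_om how hwi
    have hopen : IsOpen (ball w r ∩ {z : ℂ | z.im ≠ 0}) :=
      isOpen_ball.inter (isOpen_ne_fun continuous_im continuous_const)
    obtain ⟨z, hzB, hz⟩ := (hB.dense_compl ℝ).exists_mem_open hopen ⟨w, mem_ball_self hr, hwi⟩
    obtain ⟨r', hr', M, hM⟩ := lbdd_nonreal hB hom h0 hzB hz.2
    exact NProp.lbdd_of_point hr hC hz.1 (hM.mono fun n hn => hn z (mem_ball_self hr'))
  set h := δ / 4 with hh
  have hh0 : 0 < h := by positivity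
  have h4 : 4 * h = δ := by rw [hh]; ring
  set S : Set ℂ := {z | |z.re - c.re| ≤ h ∧ h/2 ≤ |z.im| ∧ |z.im| ≤ h} with hS
  have hSb : S ⊆ closedBall c (2*h) := by
    intro w hw
    rw [mem_closedBall, dist_eq_norm]
    have := norm_le_abs_re_add_abs_im (w - c)
    rw [sub_re, sub_im, hc, sub_zero] at this
    linarith [hw.1, hw.2.2]
  have hSc : IsCompact S := by
    apply (isCompact_closedBall c (2*h)).of_isClosed_subset _ hSb
    have i1 : IsClosed {w : ℂ | |w.re - c.re| ≤ h} := isClosed_le (by fun_prop) (by fun_prop)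
    have i2 : IsClosed {w : ℂ | h/2 ≤ |w.im|} := isClosed_le (by fun_prop) (by fun_prop)
    have i3 : IsClosed {w : ℂ | |w.im| ≤ h} := isClosed_le (by fun_prop) (by fun_prop)
    exact i1.inter (i2.inter i3)
  obtain ⟨M, hM⟩ := bdd_of_compact (l := l) (φ := γ) hSc (by
    intro w hw
    apply hnr w
    · have := hSb hw
      rw [mem_closedBall] at this
      rw [mem_ball]; linarith
    · intro h0
      have := hw.2.1
      rw [h0, abs_zero] at this
      linarith)
  obtain ⟨ρ, hρ, K, hK⟩ := real_bound hc (V := (1 + Real.log (1 + L)) * (1 + Real.log (1 + M))) hh0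
  have hA : 0 ≤ Real.log (1 + L) := Real.log_nonneg (by linarith)
  refine ⟨min ρ δ, by positivity, L * (1 + K), ?_⟩
  filter_upwards [hev, hM] with n hn hnM x hx
  obtain ⟨k, h1, h2, h3⟩ := hn
  have := hK k (by rwa [h4]) (by rwa [h4]) (by
    intro z a b d
    have hzS : z ∈ S := ⟨a, b, d⟩
    have hz : z ∈ ball c δ := by
      have := hSb hzS
      rw [mem_closedBall] at this
      rw [mem_ball]; linarith
    refine (Lam_comp hL (h3 z hz).1).trans ?_
    have := Lam_le_of_norm_le (hnM z hzS)
    gcongr) x (ball_subset_ball (min_le_left _ _) hx)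
  refine (h3 x (ball_subset_ball (min_le_right _ _) hx)).2.trans ?_
  gcongr


lemma final_contra {l : Filter ℕ} [l.NeBot] {g : ℂ → ℂ} (hg : Differentiable ℂ g) {s R : ℕ → ℝ} {ζ : ℕ → ℂ}
    (hs : ∀ n, 0 < s n) (hR : ∀ n, 0 < R n) (hRt : Tendsto R l atTop)
    (hRs : ∀ m : ℕ, ∀ᶠ n in l, R n ^ m ≤ s n) (hζ : ∀ n, ‖ζ n‖ = 1) (hgζ : ∀ n, ‖g (R n * ζ n)‖ = s n)
    {t M : ℝ} (ht : 1 < t) (hM : ∀ᶠ n in l, ∀ z ∈ sphere (0:ℂ) t, ‖g (R n * z) / s n‖ ≤ M) : False := by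
  have ht0 : 0 < t := by linarith
  set γ : ℕ → ℂ → ℂ := fun n z => g (R n * z) / s n with hγ
  have hγd : ∀ n, Differentiable ℂ (γ n) := by
    intro n
    apply Differentiable.div_const
    exact hg.comp (by fun_prop)
  have hcoef : ∀ n k, iteratedDeriv k (γ n) 0 = (R n : ℂ) ^ k * iteratedDeriv k g 0 / s n := by
    intro n k
    rw [hγ]
    simp only
    rw [iteratedDeriv_div_const, iteratedDeriv_comp_const_mul hg.contDiff]
    simp
  have T := tendsto_tsum_of_dominated_convergence (𝓕 := l)
    (f := fun n k => ((k.factorial : ℂ))⁻¹ • (ζ n - 0) ^ k • iteratedDeriv k (γ n) 0)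
    (g := fun _ => (0:ℂ)) (bound := fun k => M * (t⁻¹) ^ k)
    ((summable_geometric_of_lt_one (by positivity) (inv_lt_one_of_one_lt₀ ht)).mul_left M) ?_ ?_
  · simp only [tsum_zero] at T
    have h1 : (fun n => ∑' k : ℕ, ((k.factorial : ℂ))⁻¹ • (ζ n - 0) ^ k • iteratedDeriv k (γ n) 0) =
        fun n => γ n (ζ n) := by
      funext n
      exact Complex.taylorSeries_eq_of_entire (hγd n) 0 (ζ n)
    rw [h1] at T
    have h2 := T.norm
    have h3 : (fun n => ‖γ n (ζ n)‖) = fun _ => (1:ℝ) := by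
      funext n
      rw [hγ]
      simp only
      rw [norm_div, hgζ, norm_real, Real.norm_of_nonneg (hs n).le, div_self (hs n).ne']
    rw [h3, norm_zero] at h2
    exact one_ne_zero (tendsto_nhds_unique tendsto_const_nhds h2)
  · intro k
    apply squeeze_zero_norm' (a := fun n => ‖iteratedDeriv k g 0‖ * (R n)⁻¹)
    · filter_upwards [hRs (k+1)] with n hn
      rw [norm_smul, norm_smul, sub_zero, norm_pow, hζ, one_pow, one_mul, hcoef, norm_div, norm_mul, norm_pow,
        norm_real, norm_real, Real.norm_of_nonneg (hs n).le, Real.norm_of_nonneg (hR n).le, norm_inv,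
        Complex.norm_natCast]
      have f1 : ((k.factorial : ℝ))⁻¹ ≤ 1 := inv_le_one_of_one_le₀ (by exact_mod_cast Nat.one_le_of_lt k.factorial_pos)
      have hRn := hR n
      have hsn := hs n
      calc _ ≤ 1 * (R n ^ k * ‖iteratedDeriv k g 0‖ / R n ^ (k+1)) := by gcongr
        _ = _ := by rw [pow_succ]; field_simp
    · have := (tendsto_inv_atTop_zero.comp hRt).const_mul ‖iteratedDeriv k g 0‖
      rw [mul_zero] at this
      exact this
  · filter_upwards [hM] with n hn k
    have := Complex.norm_iteratedDeriv_le_of_forall_mem_sphere_norm_le k ht0 (hγd n).diffContOnCl hn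
    rw [norm_smul, norm_smul, sub_zero, norm_pow, hζ, one_pow, one_mul, norm_inv, Complex.norm_natCast]
    have hk : (0:ℝ) < k.factorial := by exact_mod_cast k.factorial_pos
    calc _ ≤ ((k.factorial : ℝ))⁻¹ * (k.factorial * M / t ^ k) := by gcongr
      _ = _ := by rw [inv_pow]; field_simp

lemma main_aux (f g : ℂ → ℂ) (hf : Differentiable ℂ f) (hg : Differentiable ℂ g)
    (hft : ¬ ∃ p : Polynomial ℂ, ∀ z : ℂ, f z = p.eval z)
    (hgt : ¬ ∃ p : Polynomial ℂ, ∀ z : ℂ, g z = p.eval z) {C₀ : ℝ}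
    (hfin : ∀ z : ℂ, f (g z) = z → z.im ≠ 0 → ‖z‖ ≤ C₀) : False := by
  obtain ⟨s, R, β, ζ, hs, hR, hRt, hRs, hβ, hfβ, hζ, hgζ, hgle, hunb⟩ := setup hf hg hft hgt
  set 𝒰 : Ultrafilter ℕ := hyperfilter ℕ
  have hle : (𝒰 : Filter ℕ) ≤ atTop := Nat.hyperfilter_le_atTop
  have hRU : Tendsto R 𝒰 atTop := hRt.mono_left hle
  set φ : ℕ → ℂ → ℂ := fun n w => f (s n * w) / R n with hφ
  set γ : ℕ → ℂ → ℂ := fun n z => g (R n * z) / s n with hγ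
  have hφd : ∀ n, Differentiable ℂ (φ n) := by
    intro n
    apply Differentiable.div_const
    exact hf.comp (by fun_prop)
  have hγd : ∀ n, Differentiable ℂ (γ n) := by
    intro n
    apply Differentiable.div_const
    exact hg.comp (by fun_prop)
  have hφn : ∀ n w, ‖φ n w‖ = ‖f (s n * w)‖ / R n := by
    intro n w
    rw [hφ]
    simp only
    rw [norm_div, norm_real, Real.norm_of_nonneg (hR n).le]
  have hγn : ∀ n w, ‖γ n w‖ = ‖g (R n * w)‖ / s n := by
    intro n w
    rw [hγ]
    simp only
    rw [norm_div, norm_real, Real.norm_of_nonneg (hs n).le]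
  have hR1 : ∀ᶠ n in (𝒰 : Filter ℕ), 1 ≤ R n := hRU.eventually_ge_atTop 1
  obtain ⟨p, q, hpq, hp, hq⟩ := two_spots (𝒰 := 𝒰) hφd hβ
    ⟨‖f 0‖, hR1.mono fun n hn => by
      rw [hφn, mul_zero]; exact div_le_self (norm_nonneg _) hn⟩
    ⟨1, hR1.mono fun n hn => by
      rw [hφn]; exact (div_le_self (norm_nonneg _) hn).trans (hfβ n)⟩
    (fun M => ((hunb M).filter_mono hle).mono fun n ⟨w, hw, hwM⟩ => ⟨w, hw, by
      rw [hφn, lt_div_iff₀ (hR n)]; exact hwM⟩)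
  obtain ⟨B, hB, hom⟩ := om_exists (𝒰 := 𝒰) hφd hγd hpq hp hq (by
    intro ε hε
    filter_upwards [hRU.eventually_gt_atTop (C₀ / ε)] with n hn z hz hzi heq
    have hRn := hR n
    have hRc : (R n : ℂ) ≠ 0 := by exact_mod_cast hRn.ne'
    have hsc : (s n : ℂ) ≠ 0 := by exact_mod_cast (hs n).ne'
    have h1 : f (g (R n * z)) = R n * z := by
      have : f (s n * (g (R n * z) / s n)) / R n = z := heq
      rw [mul_div_cancel₀ _ hsc, div_eq_iff hRc] at this
      rw [this, mul_comm]
    have h2 := hfin _ h1 (by rw [im_ofReal_mul]; exact mul_ne_zero hRn.ne' hzi)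
    rw [norm_mul, norm_real, Real.norm_of_nonneg hRn.le] at h2
    rw [div_lt_iff₀ hε] at hn
    have : R n * ε ≤ R n * ‖z‖ := by gcongr
    linarith)
  have h0 : ∀ c : ℂ, ‖c‖ < 1 → LBdd 𝒰 γ c := by
    intro c hc
    refine ⟨1 - ‖c‖, by linarith, 1, Eventually.of_forall fun n x hx => ?_⟩
    rw [hγn, div_le_one (hs n)]
    apply hgle
    rw [mem_ball, dist_eq_norm] at hx
    have := norm_le_norm_add_norm_sub c x
    rw [norm_sub_rev] at this
    linarith
  obtain ⟨t, htB, ht1, ht2⟩ := ((hB.image norm).dense_compl ℝ).exists_mem_open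
    (isOpen_Ioo (a := (1:ℝ)) (b := 2)) ⟨3/2, by norm_num, by norm_num⟩
  obtain ⟨M, hM⟩ := bdd_of_compact (l := (𝒰 : Filter ℕ)) (φ := γ) (isCompact_sphere (0:ℂ) t) (by
    intro c hc
    have hcB : c ∉ B := by
      intro h
      apply htB
      exact ⟨c, h, by simpa using hc⟩
    by_cases hci : c.im = 0
    · exact lbdd_real hB hom h0 hcB hci
    · exact lbdd_nonreal hB hom h0 hcB hci)
  exact final_contra hg hs hR hRU (fun m => (hRs m).filter_mono hle) hζ hgζ ht1 hM

end

/-- If `f` and `g` are transcendental entire functions, then `f ∘ g` has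
infinitely many nonreal fixed points. -/
theorem composite_entire_infinitely_many_nonreal_fixed_points
    (f g : ℂ → ℂ)
    (hf : Differentiable ℂ f) (hg : Differentiable ℂ g)
    (hf_transc : ¬ ∃ p : Polynomial ℂ, ∀ z : ℂ, f z = p.eval z)
    (hg_transc : ¬ ∃ p : Polynomial ℂ, ∀ z : ℂ, g z = p.eval z) :
    {z : ℂ | f (g z) = z ∧ z.im ≠ 0}.Infinite := by
  intro hfin
  obtain ⟨C₀, hC₀⟩ := hfin.isBounded.exists_norm_le
  exact main_aux f g hf hg hf_transc hg_transc (C₀ := C₀) (fun z h1 h2 => hC₀ z ⟨h1, h2⟩)
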